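/- arXiv:math/0506391 — 8 statements merged into one kernel-verified Lean document; each statement's English description precedes it below -/
import Mathlib

section
/- Let A be a commutative Noetherian ring and let B be a Noetherian ℕ-graded A-algebra whose degree-0 component is A (that is, B = ⊕_{d≥0} B_d with B_0 = A·1, the image of A). Let P be a finitely generated graded B-module that is relatively projective with respect to A. Then P is relatively free: there exist an A-module N and an isomorphism of B-modules P ≅ B ⊗_A N. In fact one may take N = P/B_+P, where B_+ = ⊕_{d>0} B_d is the irrelevant ideal. -/
open TensorProduct

universe u

/-- A `B`-module `P` is *relatively projective* with respect to `A` if for every surjective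
`B`-module homomorphism `g : M → M''` admitting an `A`-linear section, every `B`-module
homomorphism `P → M''` lifts to a `B`-module homomorphism `P → M`. -/
def IsRelativelyProjective (A B : Type u) [CommRing A] [Ring B] [Algebra A B]
    (P : Type u) [AddCommGroup P] [Module A P] [Module B P] [IsScalarTower A B P] : Prop :=
  ∀ (M M'' : Type u)
    [AddCommGroup M] [Module A M] [Module B M] [IsScalarTower A B M]
    [AddCommGroup M''] [Module A M''] [Module B M''] [IsScalarTower A B M'']
    (g : M →ₗ[B] M''), Function.Surjective g →
    (∃ s : M'' →ₗ[A] M, ∀ x : M'', g (s x) = x) →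
    ∀ φ : P →ₗ[B] M'', ∃ ψ : P →ₗ[B] M, g ∘ₗ ψ = φ


section RelProjHelpers
open DirectSum

variable {A B P : Type u} [CommRing A] [Ring B] [Algebra A B]
  [AddCommGroup P] [Module A P] [Module B P] [IsScalarTower A B P]

/-- The projection onto the degree `d` component. -/
noncomputable def rpPr {M : Type u} [AddCommGroup M] [Module A M] (ℳ : ℤ → Submodule A M)
    [Decomposition ℳ] (d : ℤ) : M →ₗ[A] M :=
  (ℳ d).subtype ∘ₗ DirectSum.component A ℤ (fun i => ℳ i) d ∘ₗ
    (decomposeLinearEquiv ℳ).toLinearMap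

theorem rpPr_apply {M : Type u} [AddCommGroup M] [Module A M] (ℳ : ℤ → Submodule A M)
    [Decomposition ℳ] (d : ℤ) (x : M) : rpPr ℳ d x = (decompose ℳ x d : M) := rfl

theorem rpPr_mem {M : Type u} [AddCommGroup M] [Module A M] (ℳ : ℤ → Submodule A M)
    [Decomposition ℳ] (d : ℤ) (x : M) : rpPr ℳ d x ∈ ℳ d := (decompose ℳ x d).2

theorem rpPr_same {M : Type u} [AddCommGroup M] [Module A M] (ℳ : ℤ → Submodule A M)
    [Decomposition ℳ] {d : ℤ} {x : M} (hx : x ∈ ℳ d) : rpPr ℳ d x = x :=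
  decompose_of_mem_same ℳ hx

theorem rpPr_ne {M : Type u} [AddCommGroup M] [Module A M] (ℳ : ℤ → Submodule A M)
    [Decomposition ℳ] {d e : ℤ} {x : M} (hx : x ∈ ℳ d) (h : d ≠ e) : rpPr ℳ e x = 0 :=
  decompose_of_mem_ne ℳ hx h

theorem rp_ind {M : Type u} [AddCommGroup M] [Module A M] (ℳ : ℤ → Submodule A M)
    [Decomposition ℳ] {p : M → Prop} (x : M)
    (hom : ∀ d, ∀ y ∈ ℳ d, p y) (add : ∀ y z, p y → p z → p (y + z)) : p x :=
  Decomposition.inductionOn ℳ (motive := p) (hom 0 0 (zero_mem _))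
    (fun {i} m => hom i m m.2) (fun y z => add y z) x

/-- Glue a family of maps on the components. -/
noncomputable def rpGlue {M Q : Type u} [AddCommGroup M] [Module A M] [AddCommGroup Q] [Module A Q]
    (ℳ : ℤ → Submodule A M) [Decomposition ℳ] (f : ℤ → M →ₗ[A] Q) : M →ₗ[A] Q :=
  DirectSum.toModule A ℤ Q (fun d => f d ∘ₗ (ℳ d).subtype) ∘ₗ
    (decomposeLinearEquiv ℳ).toLinearMap

theorem rpGlue_of_mem {M Q : Type u} [AddCommGroup M] [Module A M] [AddCommGroup Q] [Module A Q]
    (ℳ : ℤ → Submodule A M) [Decomposition ℳ] (f : ℤ → M →ₗ[A] Q) {d : ℤ} {x : M}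
    (hx : x ∈ ℳ d) : rpGlue ℳ f x = f d x := by
  have : (decomposeLinearEquiv ℳ).toLinearMap x = DirectSum.lof A ℤ (fun i => ℳ i) d ⟨x, hx⟩ :=
    decompose_of_mem ℳ hx
  simp only [rpGlue, LinearMap.comp_apply, this, DirectSum.toModule_lof]
  rfl

/-- `b ⊗ n ↦ b • f n`. -/
noncomputable def rpLift {N : Type u} [AddCommGroup N] [Module A N] (f : N →ₗ[A] P) :
    B ⊗[A] N →ₗ[B] P :=
  { TensorProduct.lift (LinearMap.compl₂ (LinearMap.mk₂ A (fun (b : B) (p : P) => b • p)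
      (fun _ _ _ => add_smul _ _ _) (fun _ _ _ => smul_assoc _ _ _)
      (fun _ _ _ => smul_add _ _ _) (fun c m n => smul_comm m c n)) f) with
    map_smul' := by
      intro b x
      induction x with
      | zero => simp
      | add x y hx hy => simp only [smul_add, map_add, AddHom.toFun_eq_coe, LinearMap.coe_toAddHom] at *; rw [hx, hy]
      | tmul c n => simp [TensorProduct.smul_tmul', mul_smul] }

@[simp] theorem rpLift_tmul {N : Type u} [AddCommGroup N] [Module A N] (f : N →ₗ[A] P)
    (b : B) (n : N) : rpLift f (b ⊗ₜ[A] n) = b • f n := rfl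

variable (𝒜 : ℤ → Submodule A B) [GradedAlgebra 𝒜]
  (ℳ : ℤ → Submodule A P) [SetLike.GradedSMul 𝒜 ℳ] [Decomposition ℳ]

theorem rpPr_smul {i : ℤ} {c : B} (hc : c ∈ 𝒜 i) (d : ℤ) (p : P) :
    rpPr ℳ d (c • p) = c • rpPr ℳ (d - i) p := by
  induction p using rp_ind ℳ with
  | hom e y hy =>
    have hm : c • y ∈ ℳ (i + e) := SetLike.GradedSMul.smul_mem hc hy
    by_cases h : i + e = d
    · subst h
      rw [rpPr_same ℳ hm, show i + e - i = e by ring, rpPr_same ℳ hy]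
    · rw [rpPr_ne ℳ hm h, rpPr_ne ℳ hy (by omega), smul_zero]
  | add y z hy hz => simp only [smul_add, map_add, hy, hz]

theorem rpPr_zero_mul (hneg : ∀ d : ℤ, d < 0 → 𝒜 d = ⊥) (x y : B) :
    rpPr 𝒜 0 (x * y) = rpPr 𝒜 0 x * rpPr 𝒜 0 y := by
  induction x using rp_ind 𝒜 with
  | add x z hx hz => simp only [add_mul, map_add, hx, hz]
  | hom i x hx =>
    induction y using rp_ind 𝒜 with
    | add x z hx hz => simp only [mul_add, map_add, hx, hz]
    | hom j y hy =>
      rcases lt_or_ge i 0 with hi | hi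
      · rw [hneg i hi, Submodule.mem_bot] at hx
        simp [hx]
      rcases lt_or_ge j 0 with hj | hj
      · rw [hneg j hj, Submodule.mem_bot] at hy
        simp [hy]
      have hm : x * y ∈ 𝒜 (i + j) := SetLike.GradedMul.mul_mem hx hy
      by_cases hi0 : i = 0
      · subst hi0
        by_cases hj0 : j = 0
        · subst hj0
          rw [rpPr_same 𝒜 hx, rpPr_same 𝒜 hy, rpPr_same 𝒜 (by simpa using hm)]
        · rw [rpPr_ne 𝒜 hm (by omega), rpPr_ne 𝒜 hy hj0, mul_zero]
      · rw [rpPr_ne 𝒜 hm (by omega), rpPr_ne 𝒜 hx hi0, zero_mul]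

/-- Total degree `d` projection on `B ⊗ P`. -/
noncomputable def rpT (d : ℤ) : B ⊗[A] P →ₗ[A] B ⊗[A] P :=
  TensorProduct.lift (rpGlue (Q := P →ₗ[A] B ⊗[A] P) 𝒜 (fun i => (TensorProduct.mk A B P).compl₂ (rpPr ℳ (d - i))))

theorem rpT_tmul (d : ℤ) {i : ℤ} {c : B} (hc : c ∈ 𝒜 i) (p : P) :
    rpT 𝒜 ℳ d (c ⊗ₜ p) = c ⊗ₜ rpPr ℳ (d - i) p := by
  simp [rpT, rpGlue_of_mem 𝒜 _ hc]

theorem rp_tind {P₁ : Type u} [AddCommGroup P₁] [Module A P₁] {p : B ⊗[A] P₁ → Prop}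
    (x : B ⊗[A] P₁) (hom : ∀ i, ∀ c ∈ 𝒜 i, ∀ y : P₁, p (c ⊗ₜ y)) (add : ∀ y z, p y → p z → p (y + z)) : p x := by
  induction x with
  | zero => simpa using hom 0 0 (zero_mem _) 0
  | add x y hx hy => exact add _ _ hx hy
  | tmul c y =>
    induction c using rp_ind 𝒜 with
    | hom i c hc => exact hom i c hc y
    | add c d hc hd => rw [TensorProduct.add_tmul]; exact add _ _ hc hd

theorem rpT_smul {k : ℤ} {b : B} (hb : b ∈ 𝒜 k) (d : ℤ) (x : B ⊗[A] P) :
    rpT 𝒜 ℳ (k + d) (b • x) = b • rpT 𝒜 ℳ d x := by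
  induction x using rp_tind 𝒜 with
  | add x y hx hy => simp only [smul_add, map_add, hx, hy]
  | hom i c hc y =>
    have hm : b * c ∈ 𝒜 (k + i) := SetLike.GradedMul.mul_mem hb hc
    rw [TensorProduct.smul_tmul', smul_eq_mul, rpT_tmul 𝒜 ℳ _ hm, rpT_tmul 𝒜 ℳ _ hc,
      TensorProduct.smul_tmul', smul_eq_mul, show k + d - (k + i) = d - i by ring]

theorem rpT_mu (d : ℤ) (x : B ⊗[A] P) :
    rpLift (LinearMap.id (R := A) (M := P)) (rpT 𝒜 ℳ d x) =
      rpPr ℳ d (rpLift (LinearMap.id (R := A) (M := P)) x) := by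
  induction x using rp_tind 𝒜 with
  | add x y hx hy => simp only [map_add, hx, hy]
  | hom i c hc y =>
    rw [rpT_tmul 𝒜 ℳ _ hc, rpLift_tmul, rpLift_tmul]
    exact (rpPr_smul 𝒜 ℳ hc d y).symm

/-- A graded splitting of the multiplication map. -/
theorem rp_exists_graded_section (hP : IsRelativelyProjective A B P) :
    ∃ σ : P →ₗ[B] B ⊗[A] P,
      (∀ p, rpLift (LinearMap.id (R := A) (M := P)) (σ p) = p) ∧
      ∀ d, ∀ p ∈ ℳ d, ∃ x, σ p = rpT 𝒜 ℳ d x := by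
  obtain ⟨s, hs⟩ := hP (B ⊗[A] P) P (rpLift (LinearMap.id (R := A) (M := P)))
    (fun p => ⟨1 ⊗ₜ p, by simp⟩) ⟨TensorProduct.mk A B P 1, fun p => by simp⟩ LinearMap.id
  have hs' : ∀ p, rpLift (LinearMap.id (R := A) (M := P)) (s p) = p :=
    fun p => LinearMap.congr_fun hs p
  let s0 : P →ₗ[A] B ⊗[A] P := rpGlue ℳ (fun d => rpT 𝒜 ℳ d ∘ₗ s.restrictScalars A)
  have h0 : ∀ d, ∀ p ∈ ℳ d, s0 p = rpT 𝒜 ℳ d (s p) := fun d p hp => rpGlue_of_mem ℳ _ hp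
  refine ⟨{ s0 with map_smul' := ?_ }, ?_, ?_⟩
  · intro b p
    change s0 (b • p) = b • s0 p
    induction p using rp_ind ℳ with
    | add x y hx hy => simp only [smul_add, map_add, hx, hy]
    | hom d p hp =>
      induction b using rp_ind 𝒜 with
      | add x y hx hy => simp only [add_smul, map_add, hx, hy]
      | hom k b hb =>
        have hm : b • p ∈ ℳ (k + d) := SetLike.GradedSMul.smul_mem hb hp
        rw [h0 _ _ hm, h0 _ _ hp, map_smul, rpT_smul 𝒜 ℳ hb]
  · intro p
    change rpLift (LinearMap.id (R := A) (M := P)) (s0 p) = p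
    induction p using rp_ind ℳ with
    | add x y hx hy => simp only [map_add, hx, hy]
    | hom d p hp => rw [h0 _ _ hp, rpT_mu, hs', rpPr_same ℳ hp]
  · intro d p hp
    exact ⟨s p, h0 d p hp⟩

/-- Lower bound on degrees. -/
theorem rp_bdd (hneg : ∀ d : ℤ, d < 0 → 𝒜 d = ⊥) [Module.Finite B P] :
    ∃ m : ℤ, ∀ d < m, ∀ p ∈ ℳ d, p = 0 := by
  classical
  obtain ⟨s, hs⟩ := (Module.Finite.fg_top (R := B) (M := P))
  have h1 : ∀ x : P, ∃ m : ℤ, ∀ d < m, rpPr ℳ d x = 0 := by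
    intro x
    induction x using rp_ind ℳ with
    | hom e y hy => exact ⟨e, fun d hd => rpPr_ne ℳ hy (by omega)⟩
    | add x y hx hy =>
      obtain ⟨a, ha⟩ := hx
      obtain ⟨b, hb⟩ := hy
      refine ⟨min a b, fun d hd => ?_⟩
      rw [map_add, ha d (by omega), hb d (by omega), add_zero]
  choose f hf using h1
  obtain ⟨m, hm⟩ : ∃ m : ℤ, ∀ x ∈ s, m ≤ f x := by
    obtain ⟨m, hm⟩ := (s.image f).bddBelow
    exact ⟨m, fun x hx => hm (by simpa using ⟨x, hx, rfl⟩)⟩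
  have key : ∀ x : P, ∀ d < m, rpPr ℳ d x = 0 := by
    intro x
    have hx : x ∈ Submodule.span B (s : Set P) := hs ▸ Submodule.mem_top
    induction hx using Submodule.span_induction with
    | mem x hx => exact fun d hd => hf x d (lt_of_lt_of_le hd (hm x hx))
    | zero => simp
    | add x y _ _ hx hy => intro d hd; rw [map_add, hx d hd, hy d hd, add_zero]
    | smul b x _ hx =>
      intro d hd
      induction b using rp_ind 𝒜 with
      | add a b ha hb => rw [add_smul, map_add, ha, hb, add_zero]
      | hom i c hc =>
        rcases lt_or_ge i 0 with hi | hi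
        · rw [hneg i hi, Submodule.mem_bot] at hc
          simp [hc]
        · rw [rpPr_smul 𝒜 ℳ hc, hx _ (by omega), smul_zero]
  exact ⟨m, fun d hd p hp => by rw [← rpPr_same ℳ hp, key p d hd]⟩

/-- Induction along a degree bounded below. -/
theorem rp_deg_ind {m : ℤ} (hm : ∀ d < m, ∀ p ∈ ℳ d, p = 0) {C : P → Prop} (hC : C 0)
    (add : ∀ y z, C y → C z → C (y + z))
    (step : ∀ d, (∀ e < d, ∀ p ∈ ℳ e, C p) → ∀ p ∈ ℳ d, C p) (p : P) : C p := by
  have : ∀ n : ℕ, ∀ d < m + n, ∀ p ∈ ℳ d, C p := by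
    intro n
    induction n with
    | zero => intro d hd p hp; rw [hm d (by simpa using hd) p hp]; exact hC
    | succ n ih =>
      intro d hd
      exact step d (fun e he => ih e (by push_cast at hd; omega))
  induction p using rp_ind ℳ with
  | add y z hy hz => exact add y z hy hz
  | hom d p hp => exact this (d - m + 1).toNat d (by omega) p hp

end RelProjHelpers

/-- Let `A` be a commutative Noetherian ring and `B` a Noetherian
`ℕ`-graded `A`-algebra (here encoded as a `ℤ`-graded algebra whose components of negative
degree vanish) with degree-zero component equal to the image of `A`.  If `P` is a finitely
generated graded `B`-module that is relatively projective with respect to `A`, then `P` is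
relatively free: there are an `A`-module `N` and an isomorphism of `B`-modules
`P ≅ B ⊗[A] N`; in fact one may take `N = P/B₊P` where `B₊` is the irrelevant ideal. -/
theorem isRelativelyProjective_graded_is_relativelyFree
    (A B : Type u) [CommRing A] [IsNoetherianRing A] [Ring B] [Algebra A B]
    [IsNoetherianRing B]
    (𝒜 : ℤ → Submodule A B) [GradedAlgebra 𝒜]
    (h0 : 𝒜 0 = LinearMap.range (Algebra.linearMap A B))
    (hneg : ∀ d : ℤ, d < 0 → 𝒜 d = ⊥)
    (P : Type u) [AddCommGroup P] [Module A P] [Module B P] [IsScalarTower A B P]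
    [Module.Finite B P]
    (ℳ : ℤ → Submodule A P) [SetLike.GradedSMul 𝒜 ℳ] [DirectSum.Decomposition ℳ]
    (hP : IsRelativelyProjective A B P) :
    (∃ (N : Type u) (_ : AddCommGroup N) (_ : Module A N),
        Nonempty (P ≃ₗ[B] (B ⊗[A] N))) ∧
      Nonempty (P ≃ₗ[B]
        (B ⊗[A] (P ⧸ (Submodule.restrictScalars A
          (Submodule.span B
            {x : P | ∃ d : ℤ, 0 < d ∧ ∃ b ∈ 𝒜 d, ∃ p : P, x = (b : B) • p}))))) := by
  refine (fun h => ⟨⟨_, _, _, h⟩, h⟩) ?_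
  set S : Set P := {x : P | ∃ d : ℤ, 0 < d ∧ ∃ b ∈ 𝒜 d, ∃ p : P, x = (b : B) • p} with hS
  set K : Submodule A P := Submodule.restrictScalars A (Submodule.span B S) with hK
  obtain ⟨m, hm⟩ := rp_bdd 𝒜 ℳ hneg
  obtain ⟨σ, hσ, hσd⟩ := rp_exists_graded_section 𝒜 ℳ hP
  set μ : B ⊗[A] P →ₗ[B] P := rpLift (LinearMap.id (R := A) (M := P)) with hμ
  have hμt : ∀ (b : B) (p : P), μ (b ⊗ₜ p) = b • p := fun b p => rfl
  let e : B ⊗[A] P →ₗ[A] P := (μ.restrictScalars A) ∘ₗ LinearMap.rTensor P (rpPr 𝒜 0)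
  have het : ∀ (b : B) (p : P), e (b ⊗ₜ p) = rpPr 𝒜 0 b • p := fun b p => rfl
  have hesmul : ∀ (b : B) (x : B ⊗[A] P), e (b • x) = rpPr 𝒜 0 b • e x := by
    intro b x
    induction x with
    | zero => simp
    | add x y hx hy => simp only [smul_add, map_add, hx, hy]
    | tmul c p =>
      rw [TensorProduct.smul_tmul', smul_eq_mul, het, het, rpPr_zero_mul 𝒜 hneg, mul_smul]
  let τ : P →ₗ[A] P := e ∘ₗ σ.restrictScalars A
  have hτ : ∀ p, τ p = e (σ p) := fun p => rfl
  have hτK : K ≤ LinearMap.ker τ := by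
    intro x hx
    rw [LinearMap.mem_ker]
    replace hx : x ∈ Submodule.span B S := hx
    induction hx using Submodule.span_induction with
    | mem x hx =>
      obtain ⟨d, hd, b, hb, p, rfl⟩ := hx
      rw [hτ, map_smul, hesmul, rpPr_ne 𝒜 hb (by omega), zero_smul]
    | zero => simp
    | add x y _ _ hx hy => rw [map_add, hx, hy, add_zero]
    | smul b x _ hx => rw [hτ, map_smul, hesmul, ← hτ, hx, smul_zero]
  let q : P →ₗ[A] P ⧸ K := K.mkQ
  have hqS : ∀ i > 0, ∀ c ∈ 𝒜 i, ∀ p : P, q (c • p) = 0 := by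
    intro i hi c hc p
    exact (Submodule.Quotient.mk_eq_zero K).2 (Submodule.subset_span ⟨i, hi, c, hc, p, rfl⟩)
  let Φ : B ⊗[A] (P ⧸ K) →ₗ[B] P := rpLift (K.liftQ τ hτK)
  have hΦ : ∀ (b : B) (p : P), Φ (b ⊗ₜ q p) = b • τ p := fun b p => rfl
  let Q : B ⊗[A] P →ₗ[B] B ⊗[A] (P ⧸ K) := q.baseChange B
  have hQ : ∀ (b : B) (p : P), Q (b ⊗ₜ p) = b ⊗ₜ q p := fun b p => rfl
  let Ψ : P →ₗ[B] B ⊗[A] (P ⧸ K) := Q ∘ₗ σ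
  have hΦsurj : ∀ p, p ∈ LinearMap.range Φ := by
    refine rp_deg_ind ℳ hm (zero_mem _) (fun _ _ => add_mem) ?_
    intro d ih p hp
    have key : ∀ x, μ (rpT 𝒜 ℳ d x) - e (rpT 𝒜 ℳ d x) ∈ LinearMap.range Φ := by
      intro x
      induction x using rp_tind 𝒜 with
      | add x y hx hy =>
        simp only [map_add]
        rw [add_sub_add_comm]
        exact add_mem hx hy
      | hom i c hc y =>
        rw [rpT_tmul 𝒜 ℳ d hc, hμt, het]
        rcases lt_trichotomy i 0 with hi | hi | hi
        · rw [hneg i hi, Submodule.mem_bot] at hc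
          simp [hc]
        · subst hi
          rw [rpPr_same 𝒜 hc, sub_self]
          exact zero_mem _
        · rw [rpPr_ne 𝒜 hc (by omega), zero_smul, sub_zero]
          exact Submodule.smul_mem _ _ (ih (d - i) (by omega) _ (rpPr_mem ℳ _ _))
    obtain ⟨x, hx⟩ := hσd d p hp
    have h1 := key x
    rw [← hx, hσ, ← hτ] at h1
    have h2 : τ p ∈ LinearMap.range Φ := ⟨1 ⊗ₜ q p, by rw [hΦ, one_smul]⟩
    simpa using add_mem h1 h2
  have hΨ1 : ∀ p, (1 : B) ⊗ₜ[A] q p ∈ LinearMap.range Ψ := by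
    refine rp_deg_ind ℳ hm (by simp) (fun y z hy hz => ?_) ?_
    · rw [map_add, TensorProduct.tmul_add]
      exact add_mem hy hz
    intro d ih p hp
    have key : ∀ x, Q (rpT 𝒜 ℳ d x) - (1 : B) ⊗ₜ[A] q (μ (rpT 𝒜 ℳ d x)) ∈
        LinearMap.range Ψ := by
      intro x
      induction x using rp_tind 𝒜 with
      | add x y hx hy =>
        simp only [map_add, TensorProduct.tmul_add]
        rw [add_sub_add_comm]
        exact add_mem hx hy
      | hom i c hc y =>
        rw [rpT_tmul 𝒜 ℳ d hc, hμt, hQ]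
        rcases lt_trichotomy i 0 with hi | hi | hi
        · rw [hneg i hi, Submodule.mem_bot] at hc
          simp [hc]
        · subst hi
          rw [h0] at hc
          obtain ⟨a, rfl⟩ := hc
          rw [Algebra.linearMap_apply, algebraMap_smul, map_smul, TensorProduct.tmul_smul,
            TensorProduct.smul_tmul', ← Algebra.algebraMap_eq_smul_one, sub_self]
          exact zero_mem _
        · rw [hqS i hi c hc, TensorProduct.tmul_zero, sub_zero]
          have := Submodule.smul_mem _ c (ih (d - i) (by omega) _ (rpPr_mem ℳ _ y))
          rwa [TensorProduct.smul_tmul', smul_eq_mul, mul_one] at this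
    obtain ⟨x, hx⟩ := hσd d p hp
    have h1 := key x
    rw [← hx, hσ] at h1
    have h2 : Q (σ p) ∈ LinearMap.range Ψ := ⟨p, rfl⟩
    simpa using sub_mem h2 h1
  have hΨsurj : Function.Surjective Ψ := by
    intro x
    change x ∈ LinearMap.range Ψ
    induction x with
    | zero => exact zero_mem _
    | add x y hx hy => exact add_mem hx hy
    | tmul b n =>
      obtain ⟨p, rfl⟩ := K.mkQ_surjective n
      have := Submodule.smul_mem _ b (hΨ1 p)
      rwa [TensorProduct.smul_tmul', smul_eq_mul, mul_one] at this
  have hsurj : Function.Surjective (Φ ∘ₗ Ψ) := by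
    rw [LinearMap.coe_comp]
    exact Function.Surjective.comp (fun p => hΦsurj p) hΨsurj
  have hinj : Function.Injective (Φ ∘ₗ Ψ) :=
    IsNoetherian.injective_of_surjective_endomorphism _ hsurj
  rw [LinearMap.coe_comp] at hinj
  exact ⟨LinearEquiv.ofBijective Ψ ⟨hinj.of_comp, hΨsurj⟩⟩
end

section
/- (Hochschild) Let A be a commutative Noetherian ring, let S = A[x_0,…,x_n] be a polynomial ring in n+1 variables over A, and let M be a finitely generated S-module. Then M has a finite A-split relatively projective resolution of length at most n+1: there exist S-modules P_0, …, P_{n+1}, each relatively projective with respect to A, and an exact sequence of S-modules 0 → P_{n+1} → ⋯ → P_1 → P_0 → M → 0 which is split exact as a sequence of A-modules (i.e., each surjection of a term onto its image and each inclusion of a cycle submodule admits an A-linear splitting). -/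
universe u

/-- `A`-split short exact sequence of `B`-modules. -/
def SplitSES (A B : Type u) [CommRing A] [Ring B] [Algebra A B]
    {K P M : Type u} [AddCommGroup K] [Module B K]
    [AddCommGroup P] [Module A P] [Module B P]
    [AddCommGroup M] [Module A M] [Module B M]
    (i : K →ₗ[B] P) (q : P →ₗ[B] M) : Prop :=
  Function.Injective i ∧ (∀ x, q x = 0 ↔ ∃ y, i y = x) ∧ ∃ s : M →ₗ[A] P, ∀ x, q (s x) = x

/-- relative projective dimension `< d`. -/
def RPD (A B : Type u) [CommRing A] [Ring B] [Algebra A B] :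
    ℕ → ∀ (M : Type u) [AddCommGroup M] [Module A M] [Module B M] [IsScalarTower A B M], Prop
  | 0, M, _, _, _, _ => Subsingleton M
  | d + 1, M, _, _, _, _ => ∃ (K P : Type u) (_ : AddCommGroup K) (_ : Module A K)
      (_ : Module B K) (_ : IsScalarTower A B K) (_ : AddCommGroup P) (_ : Module A P)
      (_ : Module B P) (_ : IsScalarTower A B P) (i : K →ₗ[B] P) (q : P →ₗ[B] M),
      IsRelativelyProjective A B P ∧ RPD A B d K ∧ SplitSES A B i q

theorem exists_factor {B K P X : Type u} [Ring B] [AddCommGroup K] [Module B K]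
    [AddCommGroup P] [Module B P] [AddCommGroup X] [Module B X]
    (i : K →ₗ[B] P) (hi : Function.Injective i) (f : X →ₗ[B] P) (hf : ∀ x, ∃ y, i y = f x) :
    ∃ g : X →ₗ[B] K, ∀ x, i (g x) = f x := by
  refine ⟨(LinearEquiv.ofInjective i hi).symm.toLinearMap ∘ₗ
    f.codRestrict (LinearMap.range i) (fun x => by obtain ⟨y, hy⟩ := hf x; exact ⟨y, hy⟩), ?_⟩
  intro x
  have := LinearEquiv.apply_symm_apply (LinearEquiv.ofInjective i hi)
    (f.codRestrict (LinearMap.range i) (fun x => by obtain ⟨y, hy⟩ := hf x; exact ⟨y, hy⟩) x)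
  exact congrArg Subtype.val this

section general
variable {A B : Type u} [CommRing A] [Ring B] [Algebra A B]

theorem SplitSES.exists_retraction
    {K P M : Type u} [AddCommGroup K] [Module A K] [Module B K] [IsScalarTower A B K]
    [AddCommGroup P] [Module A P] [Module B P] [IsScalarTower A B P]
    [AddCommGroup M] [Module A M] [Module B M] [IsScalarTower A B M]
    {i : K →ₗ[B] P} {q : P →ₗ[B] M} (h : SplitSES A B i q) :
    ∃ r : P →ₗ[A] K, ∀ x, q x = 0 → i (r x) = x := by
  obtain ⟨hi, hex, s, hs⟩ := h
  obtain ⟨r, hr⟩ := exists_factor (i.restrictScalars A) hi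
    (LinearMap.id - s ∘ₗ q.restrictScalars A) (fun x => by
      have : q (x - s (q x)) = 0 := by simp [hs]
      exact (hex _).1 this)
  refine ⟨r, fun x hx => ?_⟩
  have := hr x
  simpa [hx] using this

theorem relProj_of_subsingleton (P : Type u) [AddCommGroup P] [Module A P] [Module B P]
    [IsScalarTower A B P] [Subsingleton P] : IsRelativelyProjective A B P := by
  intro M M'' _ _ _ _ _ _ _ _ g _ _ φ
  refine ⟨0, ?_⟩
  ext x
  simp [Subsingleton.elim x 0]

theorem relProj_prod (P Q : Type u) [AddCommGroup P] [Module A P] [Module B P]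
    [IsScalarTower A B P] [AddCommGroup Q] [Module A Q] [Module B Q]
    [IsScalarTower A B Q] (hP : IsRelativelyProjective A B P)
    (hQ : IsRelativelyProjective A B Q) : IsRelativelyProjective A B (P × Q) := by
  intro M M'' _ _ _ _ _ _ _ _ g hg hs φ
  obtain ⟨ψ₁, h₁⟩ := hP M M'' g hg hs (φ ∘ₗ LinearMap.inl B P Q)
  obtain ⟨ψ₂, h₂⟩ := hQ M M'' g hg hs (φ ∘ₗ LinearMap.inr B P Q)
  refine ⟨ψ₁.coprod ψ₂, ?_⟩
  rw [LinearMap.comp_coprod, h₁, h₂]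
  ext x <;> simp

theorem RPD.succ {d : ℕ} : ∀ {M : Type u} [AddCommGroup M] [Module A M] [Module B M]
    [IsScalarTower A B M], RPD A B d M → RPD A B (d + 1) M := by
  induction d with
  | zero =>
    intro M _ _ _ _ h
    have : Subsingleton M := h
    refine ⟨M, M, _, _, _, ‹_›, _, _, _, ‹_›, 0, 0, relProj_of_subsingleton M, h, ?_, ?_, 0, ?_⟩
    · exact Function.injective_of_subsingleton _
    · intro x; exact ⟨fun _ => ⟨0, Subsingleton.elim _ _⟩, fun _ => Subsingleton.elim _ _⟩
    · intro x; exact Subsingleton.elim _ _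
  | succ d ih =>
    intro M _ _ _ _ h
    obtain ⟨K, P, _, _, _, _, _, _, _, _, i, q, hP, hK, h⟩ := h
    exact ⟨K, P, _, _, _, ‹_›, _, _, _, ‹_›, i, q, hP, ih hK, h⟩

theorem RPD.of_subsingleton {M : Type u} [AddCommGroup M] [Module A M] [Module B M]
    [IsScalarTower A B M] (h : Subsingleton M) (d : ℕ) : RPD A B d M := by
  induction d with
  | zero => exact h
  | succ d ih => exact ih.succ

theorem RPD.horseshoe {d : ℕ} : ∀ {M' M M'' : Type u}
    [AddCommGroup M'] [Module A M'] [Module B M'] [IsScalarTower A B M']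
    [AddCommGroup M] [Module A M] [Module B M] [IsScalarTower A B M]
    [AddCommGroup M''] [Module A M''] [Module B M''] [IsScalarTower A B M'']
    (j : M' →ₗ[B] M) (q : M →ₗ[B] M''), SplitSES A B j q →
    RPD A B d M' → RPD A B d M'' → RPD A B d M := by
  induction d with
  | zero =>
    intro M' M M'' _ _ _ _ _ _ _ _ _ _ _ _ j q h h' h''
    have : Subsingleton M' := h'
    have : Subsingleton M'' := h''
    change Subsingleton M
    refine subsingleton_of_forall_eq 0 fun x => ?_
    obtain ⟨y, hy⟩ := (h.2.1 x).1 (Subsingleton.elim _ _)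
    rw [← hy, Subsingleton.elim y 0, map_zero]
  | succ d ih =>
    intro M' M M'' _ _ _ _ _ _ _ _ _ _ _ _ j q h h' h''
    obtain ⟨K', P', _, _, _, _, _, _, _, _, i', e', hP', hK', S'⟩ := h'
    obtain ⟨K'', P'', _, _, _, _, _, _, _, _, i'', e'', hP'', hK'', S''⟩ := h''
    obtain ⟨r, hr⟩ := h.exists_retraction
    obtain ⟨hj, hex, σ, hσ⟩ := h
    obtain ⟨hi', hex', s', hs'⟩ := S'
    obtain ⟨hi'', hex'', s'', hs''⟩ := S''
    obtain ⟨φ, hφ⟩ := hP'' M M'' q (fun x => ⟨σ x, hσ x⟩) ⟨σ, hσ⟩ e''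
    have hφ (x) : q (φ x) = e'' x := LinearMap.congr_fun hφ x
    have hqj (x) : q (j x) = 0 := (hex _).2 ⟨x, rfl⟩
    have hei' (x) : e' (i' x) = 0 := (hex' _).2 ⟨x, rfl⟩
    have hei'' (x) : e'' (i'' x) = 0 := (hex'' _).2 ⟨x, rfl⟩
    let e : P' × P'' →ₗ[B] M := (j ∘ₗ e').coprod φ
    have he (x : P' × P'') : e x = j (e' x.1) + φ x.2 := rfl
    refine ⟨LinearMap.ker e, P' × P'', inferInstance, inferInstance, inferInstance,
      inferInstance, inferInstance, inferInstance, inferInstance, inferInstance,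
      (LinearMap.ker e).subtype, e, relProj_prod _ _ hP' hP'', ?_,
      Subtype.val_injective, ?_, ?_⟩
    · obtain ⟨g, hg⟩ := exists_factor i'' hi''
        (LinearMap.snd B P' P'' ∘ₗ (LinearMap.ker e).subtype) (fun x => by
          refine (hex'' _).1 ?_
          have := congrArg q (LinearMap.mem_ker.1 x.2)
          simpa [he, hqj, hφ] using this)
      have hg (x : LinearMap.ker e) : i'' (g x) = x.1.2 := hg x
      refine ih ((LinearMap.inl B P' P'' ∘ₗ i').codRestrict (LinearMap.ker e)
        (fun x => by simp [he, hei'])) g ⟨?_, ?_, ?_⟩ hK' hK''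
      · intro x y hxy
        apply hi'
        exact congrArg (fun z => z.1.1) hxy
      · intro x
        constructor
        · intro hx
          have h2 : x.1.2 = 0 := by rw [← hg, hx, map_zero]
          have h1 := LinearMap.mem_ker.1 x.2
          rw [he, h2, map_zero, add_zero] at h1
          obtain ⟨y, hy⟩ := (hex' _).1 (hj (h1.trans (map_zero j).symm))
          refine ⟨y, ?_⟩
          exact Subtype.ext (Prod.ext hy h2.symm)
        · rintro ⟨y, rfl⟩
          apply hi''
          exact (hg _).trans (map_zero i'').symm
      · let t : K'' →ₗ[A] P' := - (s' ∘ₗ r ∘ₗ φ.restrictScalars A ∘ₗ i''.restrictScalars A)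
        have ht (x) : t x = - s' (r (φ (i'' x))) := rfl
        refine ⟨(t.prod (i''.restrictScalars A)).codRestrict
          ((LinearMap.ker e).restrictScalars A) ?_, ?_⟩
        · intro x
          change e (t x, i'' x) = 0
          rw [he, ht]
          simp only [map_neg, hs']
          rw [hr _ (by rw [hφ, hei''])]
          simp
        · intro x
          apply hi''
          rw [hg]; rfl
    · intro x
      constructor
      · intro hx; exact ⟨⟨x, hx⟩, rfl⟩
      · rintro ⟨y, rfl⟩; exact y.2
    · let t : M →ₗ[A] P'' := s'' ∘ₗ q.restrictScalars A
      have ht (x) : t x = s'' (q x) := rfl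
      refine ⟨(s' ∘ₗ r ∘ₗ (LinearMap.id - φ.restrictScalars A ∘ₗ t)).prod t, ?_⟩
      intro x
      rw [he]
      change j (e' (s' (r (x - φ (t x))))) + φ (t x) = x
      rw [hs', hr]
      · simp
      · rw [map_sub, hφ, ht, hs'', sub_self]

theorem RPD.third {d : ℕ} {M' M M'' : Type u}
    [AddCommGroup M'] [Module A M'] [Module B M'] [IsScalarTower A B M']
    [AddCommGroup M] [Module A M] [Module B M] [IsScalarTower A B M]
    [AddCommGroup M''] [Module A M''] [Module B M''] [IsScalarTower A B M'']
    (j : M' →ₗ[B] M) (q : M →ₗ[B] M'') (h : SplitSES A B j q)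
    (h' : RPD A B d M') (hM : RPD A B d M) : RPD A B (d + 1) M'' := by
  cases d with
  | zero =>
    obtain ⟨hj, hex, σ, hσ⟩ := h
    have : Subsingleton M := hM
    refine RPD.of_subsingleton ?_ _
    refine subsingleton_of_forall_eq 0 fun x => ?_
    rw [← hσ x, Subsingleton.elim (σ x) 0, map_zero]
  | succ d =>
    obtain ⟨K, P, _, _, _, _, _, _, _, _, i, e, hP, hK, S⟩ := hM
    obtain ⟨hj, hex, σ, hσ⟩ := h
    obtain ⟨hi, hex', s, hs⟩ := S
    have hqj (x) : q (j x) = 0 := (hex _).2 ⟨x, rfl⟩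
    have hei (x) : e (i x) = 0 := (hex' _).2 ⟨x, rfl⟩
    refine ⟨LinearMap.ker (q ∘ₗ e), P, inferInstance, inferInstance, inferInstance,
      inferInstance, inferInstance, inferInstance, inferInstance, inferInstance,
      (LinearMap.ker (q ∘ₗ e)).subtype, q ∘ₗ e, hP, ?_,
      Subtype.val_injective, ?_, s ∘ₗ σ, ?_⟩
    · obtain ⟨g, hg⟩ := exists_factor j hj (e ∘ₗ (LinearMap.ker (q ∘ₗ e)).subtype) (fun x =>
        (hex _).1 x.2)
      have hg (x : LinearMap.ker (q ∘ₗ e)) : j (g x) = e x.1 := hg x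
      refine RPD.horseshoe (i.codRestrict (LinearMap.ker (q ∘ₗ e)) (fun x => by simp [hei])) g
        ⟨?_, ?_, ?_⟩ hK.succ h'
      · intro x y hxy
        exact hi (congrArg Subtype.val hxy)
      · intro x
        constructor
        · intro hx
          have : e x.1 = 0 := by rw [← hg, hx, map_zero]
          obtain ⟨y, hy⟩ := (hex' _).1 this
          exact ⟨y, Subtype.ext hy⟩
        · rintro ⟨y, rfl⟩
          apply hj
          exact (hg _).trans ((hei y).trans (map_zero j).symm)
      · refine ⟨(s ∘ₗ j.restrictScalars A).codRestrict
          ((LinearMap.ker (q ∘ₗ e)).restrictScalars A) ?_, ?_⟩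
        · intro x
          change q (e (s (j x))) = 0
          rw [hs, hqj]
        · intro x
          apply hj
          rw [hg]
          exact hs _
    · intro x
      constructor
      · intro hx; exact ⟨⟨x, hx⟩, rfl⟩
      · rintro ⟨y, rfl⟩; exact y.2
    · intro x
      change q (e (s (σ x))) = x
      rw [hs, hσ]

theorem relProj_of_surjective (hAB : Function.Surjective (algebraMap A B))
    (P : Type u) [AddCommGroup P] [Module A P] [Module B P]
    [IsScalarTower A B P] : IsRelativelyProjective A B P := by
  intro M M'' _ _ _ _ _ _ _ _ g _ ⟨s, hs⟩ φ
  refine ⟨{ toFun := fun x => s (φ x), map_add' := by simp, map_smul' := ?_ }, ?_⟩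
  · intro b x
    obtain ⟨a, rfl⟩ := hAB b
    simp
  · ext x
    exact hs _

theorem RPD.one {P : Type u} [AddCommGroup P] [Module A P] [Module B P]
    [IsScalarTower A B P] (h : IsRelativelyProjective A B P) : RPD A B 1 P := by
  refine ⟨PUnit, P, inferInstance, inferInstance, inferInstance, inferInstance, _, _, _, ‹_›,
    0, LinearMap.id, h, (inferInstance : Subsingleton PUnit), ?_, ?_, LinearMap.id, ?_⟩
  · exact Function.injective_of_subsingleton _
  · intro x; simp [eq_comm]
  · simp

end general

theorem relProj_transport {A B B' : Type u} [CommRing A] [Ring B] [Algebra A B] [Ring B']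
    [Algebra A B'] (e : B ≃ₐ[A] B') (P : Type u) [AddCommGroup P] [Module A P] [Module B P]
    [IsScalarTower A B P] [Module B' P] [IsScalarTower A B' P]
    (h : ∀ (b : B) (x : P), e b • x = b • x) (hP : IsRelativelyProjective A B P) :
    IsRelativelyProjective A B' P := by
  intro M M'' _ _ _ _ _ _ _ _ g hg hs φ
  let _ : Module B M := Module.compHom M (e : B →+* B')
  let _ : Module B M'' := Module.compHom M'' (e : B →+* B')
  have h1 (b : B) (x : M) : b • x = e b • x := rfl
  have h2 (b : B) (x : M'') : b • x = e b • x := rfl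
  have : IsScalarTower A B M := ⟨fun a b x => by rw [h1, h1, map_smul, smul_assoc]⟩
  have : IsScalarTower A B M'' := ⟨fun a b x => by rw [h2, h2, map_smul, smul_assoc]⟩
  obtain ⟨ψ, hψ⟩ := hP M M''
    { toFun := g, map_add' := map_add g, map_smul' := fun b x => map_smul g (e b) x } hg hs
    { toFun := φ, map_add' := map_add φ, map_smul' := fun b x => by
        rw [← h, map_smul]; rfl }
  refine ⟨{ toFun := ψ, map_add' := map_add ψ, map_smul' := fun b x => ?_ }, ?_⟩
  · obtain ⟨b, rfl⟩ := e.surjective b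
    rw [h, map_smul]; rfl
  · ext x
    exact LinearMap.congr_fun hψ x

theorem RPD.transport {A B B' : Type u} [CommRing A] [Ring B] [Algebra A B] [Ring B']
    [Algebra A B'] (e : B ≃ₐ[A] B') {d : ℕ} : ∀ (M : Type u) [AddCommGroup M] [Module A M]
    [Module B M] [IsScalarTower A B M] [Module B' M] [IsScalarTower A B' M],
    (∀ (b : B) (x : M), e b • x = b • x) → RPD A B d M → RPD A B' d M := by
  induction d with
  | zero => intro M _ _ _ _ _ _ _ h; exact h
  | succ d ih =>
    intro M _ _ _ _ _ _ h hM
    obtain ⟨K, P, _, _, _, _, _, _, _, _, i, q, hP, hK, S⟩ := hM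
    let _ : Module B' K := Module.compHom K (e.symm : B' →+* B)
    let _ : Module B' P := Module.compHom P (e.symm : B' →+* B)
    have h1 (b : B') (x : K) : b • x = e.symm b • x := rfl
    have h2 (b : B') (x : P) : b • x = e.symm b • x := rfl
    have : IsScalarTower A B' K := ⟨fun a b x => by rw [h1, h1, map_smul, smul_assoc]⟩
    have : IsScalarTower A B' P := ⟨fun a b x => by rw [h2, h2, map_smul, smul_assoc]⟩
    refine ⟨K, P, inferInstance, inferInstance, inferInstance, inferInstance,
      inferInstance, inferInstance, inferInstance, inferInstance,
      { toFun := i, map_add' := map_add i, map_smul' := fun b x => map_smul i (e.symm b) x },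
      { toFun := q, map_add' := map_add q, map_smul' := fun b x => ?_ },
      relProj_transport e P ?_ hP, ih K ?_ hK, S⟩
    · rw [h2, map_smul, ← h]; simp
    · intro b x; rw [h2]; simp
    · intro b x; rw [h1]; simp

open Polynomial in
/-- Extension of an `R`-linear map to the polynomial module. -/
noncomputable def polyLift {R N P : Type u} [CommRing R] [AddCommGroup P] [Module R P]
    [AddCommGroup N] [Module R N] [Module R[X] N] [IsScalarTower R R[X] N] (f : P →ₗ[R] N) :
    PolynomialModule R P →ₗ[R[X]] N where
  toFun p := PolynomialModule.eval (X : R[X]) (PolynomialModule.map R[X] f p)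
  map_add' := by simp
  map_smul' r x := by
    rw [PolynomialModule.map_smul, PolynomialModule.eval_smul, Polynomial.algebraMap_eq,
      Polynomial.eval_map, Polynomial.eval₂_C_X]
    rfl

open Polynomial in
theorem polyLift_single {R N P : Type u} [CommRing R] [AddCommGroup P] [Module R P]
    [AddCommGroup N] [Module R N] [Module R[X] N] [IsScalarTower R R[X] N] (f : P →ₗ[R] N)
    (i : ℕ) (x : P) : polyLift f (PolynomialModule.single R i x) = (X : R[X]) ^ i • f x := by
  simp [polyLift]

section poly
open Polynomial
variable {A R : Type u} [CommRing A] [CommRing R] [Algebra A R]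

theorem poly_hom_ext {N P : Type u} [AddCommGroup P] [Module R P]
    [AddCommGroup N] [Module R[X] N] (f g : PolynomialModule R P →ₗ[R[X]] N)
    (h : ∀ x, f (PolynomialModule.single R 0 x) = g (PolynomialModule.single R 0 x)) : f = g := by
  ext p
  induction p using PolynomialModule.induction_linear with
  | zero => simp
  | add x y hx hy => simp [hx, hy]
  | single n m =>
    have : PolynomialModule.single R n m = (monomial n (1 : R)) • PolynomialModule.single R 0 m := by
      simp
    rw [this, map_smul, map_smul, h]

theorem relProj_poly (P : Type u) [AddCommGroup P] [Module A P] [Module R P]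
    [IsScalarTower A R P] (hP : IsRelativelyProjective A R P) :
    IsRelativelyProjective A R[X] (PolynomialModule R P) := by
  intro M M'' _ _ _ _ _ _ _ _ g hg hs φ
  let _ : Module R M := Module.compHom M (C : R →+* R[X])
  let _ : Module R M'' := Module.compHom M'' (C : R →+* R[X])
  have h1 (b : R) (x : M) : b • x = (C b : R[X]) • x := rfl
  have h2 (b : R) (x : M'') : b • x = (C b : R[X]) • x := rfl
  have : IsScalarTower R R[X] M := ⟨fun a b x => by
    rw [h1, Polynomial.smul_eq_C_mul, mul_smul]⟩
  have : IsScalarTower R R[X] M'' := ⟨fun a b x => by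
    rw [h2, Polynomial.smul_eq_C_mul, mul_smul]⟩
  have : IsScalarTower A R M := ⟨fun a b x => by
    rw [h1, h1, ← Polynomial.smul_C, smul_assoc]⟩
  have : IsScalarTower A R M'' := ⟨fun a b x => by
    rw [h2, h2, ← Polynomial.smul_C, smul_assoc]⟩
  obtain ⟨ψ, hψ⟩ := hP M M'' (g.restrictScalars R) hg hs
    (φ.restrictScalars R ∘ₗ PolynomialModule.lsingle R 0)
  refine ⟨polyLift ψ, poly_hom_ext _ _ fun x => ?_⟩
  have := LinearMap.congr_fun hψ x
  rw [LinearMap.comp_apply, polyLift_single, pow_zero, one_smul]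
  exact this

/-- Functoriality of the polynomial module. -/
noncomputable def polyMap {N P : Type u} [AddCommGroup P] [Module R P]
    [AddCommGroup N] [Module R N] (f : P →ₗ[R] N) :
    PolynomialModule R P →ₗ[R[X]] PolynomialModule R N where
  toFun p := PolynomialModule.map R f p
  map_add' := by simp
  map_smul' r x := by
    rw [PolynomialModule.map_smul]; simp

theorem polyMap_coeff {N P : Type u} [AddCommGroup P] [Module R P]
    [AddCommGroup N] [Module R N] (f : P →ₗ[R] N) (p : PolynomialModule R P) (n : ℕ) :
    (polyMap f p).coeff n = f (p.coeff n) := rfl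

theorem RPD.poly {d : ℕ} : ∀ (M : Type u) [AddCommGroup M] [Module A M] [Module R M]
    [IsScalarTower A R M], RPD A R d M → RPD A R[X] d (PolynomialModule R M) := by
  induction d with
  | zero =>
    intro M _ _ _ _ h
    have : Subsingleton M := h
    change Subsingleton _
    infer_instance
  | succ d ih =>
    intro M _ _ _ _ h
    obtain ⟨K, P, _, _, _, _, _, _, _, _, i, q, hP, hK, hi, hex, s, hs⟩ := h
    refine ⟨PolynomialModule R K, PolynomialModule R P, inferInstance, inferInstance,
      inferInstance, inferInstance, inferInstance, inferInstance, inferInstance, inferInstance,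
      polyMap i, polyMap q, relProj_poly P hP, ih K hK, ?_, ?_, ?_⟩
    · intro x y hxy
      ext n
      apply hi
      rw [← polyMap_coeff, hxy, polyMap_coeff]
    · intro x
      constructor
      · intro hx
        have (n : ℕ) : ∃ y, i y = x.coeff n := by
          rw [← hex, ← polyMap_coeff, hx]; rfl
        choose y hy using this
        refine ⟨.ofCoeff R (Finsupp.onFinset x.coeff.support y ?_), ?_⟩
        · intro n hn
          rw [Finsupp.mem_support_iff, ← hy]
          intro h0
          exact hn (hi (h0.trans (map_zero i).symm))
        · ext n
          rw [polyMap_coeff]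
          exact hy n
      · rintro ⟨y, rfl⟩
        ext n
        rw [polyMap_coeff, polyMap_coeff]
        exact (hex _).2 ⟨_, rfl⟩
    · refine ⟨(PolynomialModule.coeffLinearEquiv R A).symm.toLinearMap ∘ₗ
        Finsupp.mapRange.linearMap s ∘ₗ
        (PolynomialModule.coeffLinearEquiv R A).toLinearMap, ?_⟩
      intro x
      ext n
      rw [polyMap_coeff]
      exact hs _

theorem RPD.poly_step (d : ℕ)
    (hR : ∀ (M : Type u) [AddCommGroup M] [Module A M] [Module R M] [IsScalarTower A R M],
      RPD A R d M)
    (M : Type u) [AddCommGroup M] [Module A M] [Module R[X] M] [IsScalarTower A R[X] M] :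
    RPD A R[X] (d + 1) M := by
  let _ : Module R M := Module.compHom M (C : R →+* R[X])
  have h1 (b : R) (x : M) : b • x = (C b : R[X]) • x := rfl
  have : IsScalarTower R R[X] M := ⟨fun a b x => by
    rw [h1, Polynomial.smul_eq_C_mul, mul_smul]⟩
  have : IsScalarTower A R M := ⟨fun a b x => by
    rw [h1, h1, ← Polynomial.smul_C, smul_assoc]⟩
  let δ : PolynomialModule R M →ₗ[R[X]] PolynomialModule R M :=
    polyLift (PolynomialModule.lsingle R 1 -
      PolynomialModule.lsingle R 0 ∘ₗ Algebra.lsmul R R M (X : R[X]))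
  let ε : PolynomialModule R M →ₗ[R[X]] M := polyLift LinearMap.id
  let h : PolynomialModule R M →ₗ[R] PolynomialModule R M :=
    Finsupp.lsum ℕ (fun i : ℕ => ∑ j ∈ Finset.range i,
      PolynomialModule.lsingle R j ∘ₗ Algebra.lsmul R R M (X ^ (i - 1 - j) : R[X])) ∘ₗ
      (PolynomialModule.coeffLinearEquiv R R).toLinearMap
  have hX (i j : ℕ) (m : M) : (X : R[X]) ^ i • PolynomialModule.single R j m =
      PolynomialModule.single R (i + j) m := by
    rw [X_pow_eq_monomial]; simp
  have hsub (i : ℕ) (m m' : M) : PolynomialModule.single R i (m - m') =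
      PolynomialModule.single R i m - PolynomialModule.single R i m' :=
    map_sub (PolynomialModule.lsingle R i) m m'
  have hδ (i : ℕ) (m : M) : δ (PolynomialModule.single R i m) =
      PolynomialModule.single R (i + 1) m - PolynomialModule.single R i ((X : R[X]) • m) := by
    rw [polyLift_single]
    change (X : R[X]) ^ i • (PolynomialModule.single R 1 m -
      PolynomialModule.single R 0 ((X : R[X]) • m)) = _
    rw [smul_sub, hX, hX, add_zero]
  have hε (i : ℕ) (m : M) : ε (PolynomialModule.single R i m) = (X : R[X]) ^ i • m :=
    polyLift_single _ _ _
  have hh (i : ℕ) (m : M) : h (PolynomialModule.single R i m) =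
      ∑ j ∈ Finset.range i, PolynomialModule.single R j ((X : R[X]) ^ (i - 1 - j) • m) := by
    simp only [h, LinearMap.comp_apply]
    erw [Finsupp.lsum_single]
    rw [LinearMap.sum_apply]
    rfl
  have hhδ (x) : h (δ x) = x := by
    induction x using PolynomialModule.induction_linear with
    | zero => simp
    | add x y hx hy => rw [map_add, map_add, hx, hy]
    | single i m =>
      rw [hδ, map_sub, hh, hh, Finset.sum_range_succ]
      have : ∀ j ∈ Finset.range i, PolynomialModule.single R j ((X : R[X]) ^ (i + 1 - 1 - j) • m) =
          PolynomialModule.single R j ((X : R[X]) ^ (i - 1 - j) • (X : R[X]) • m) := by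
        intro j hj
        rw [smul_smul, ← pow_succ]
        congr 3
        have := Finset.mem_range.1 hj
        omega
      rw [Finset.sum_congr rfl this]
      simp
  have hδh (x) : δ (h x) = x - PolynomialModule.single R 0 (ε x) := by
    induction x using PolynomialModule.induction_linear with
    | zero => simp
    | add x y hx hy => rw [map_add, map_add, hx, hy, map_add, PolynomialModule.single_add]; abel
    | single i m =>
      rw [hh, map_sum, hε]
      have : ∀ j ∈ Finset.range i,
          δ (PolynomialModule.single R j ((X : R[X]) ^ (i - 1 - j) • m)) =
          (fun j => PolynomialModule.single R j ((X : R[X]) ^ (i - j) • m)) (j + 1) -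
          (fun j => PolynomialModule.single R j ((X : R[X]) ^ (i - j) • m)) j := by
        intro j hj
        have := Finset.mem_range.1 hj
        rw [hδ, smul_smul, ← pow_succ']
        simp only
        rw [show i - 1 - j = i - (j + 1) by omega, show i - (j + 1) + 1 = i - j by omega]
      rw [Finset.sum_congr rfl this,
        Finset.sum_range_sub (fun j => PolynomialModule.single R j ((X : R[X]) ^ (i - j) • m))]
      simp
  refine RPD.third δ ε ⟨?_, ?_, ?_⟩ (RPD.poly M (hR M)) (RPD.poly M (hR M))
  · exact Function.LeftInverse.injective hhδ
  · intro x
    constructor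
    · intro hx
      refine ⟨h x, ?_⟩
      rw [hδh, hx]; simp
    · rintro ⟨y, rfl⟩
      induction y using PolynomialModule.induction_linear with
      | zero => simp
      | add x y hx hy => rw [map_add, map_add, hx, hy, add_zero]
      | single i m =>
        rw [hδ, map_sub, hε, hε, smul_smul, ← pow_succ, sub_self]
  · refine ⟨(PolynomialModule.lsingle R 0).restrictScalars A, ?_⟩
    intro x
    change ε (PolynomialModule.single R 0 x) = x
    rw [hε]; simp

theorem RPD.mvPolynomial (m : ℕ) : ∀ (M : Type u) [AddCommGroup M] [Module A M]
    [Module (MvPolynomial (Fin m) A) M] [IsScalarTower A (MvPolynomial (Fin m) A) M],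
    RPD A (MvPolynomial (Fin m) A) (m + 1) M := by
  induction m with
  | zero =>
    intro M _ _ _ _
    exact RPD.one (relProj_of_surjective (MvPolynomial.C_surjective (Fin 0)) M)
  | succ m ih =>
    intro M _ _ _ _
    let e := (MvPolynomial.finSuccEquiv A m).symm
    let _ : Module (Polynomial (MvPolynomial (Fin m) A)) M := Module.compHom M
      (e : Polynomial (MvPolynomial (Fin m) A) →+* MvPolynomial (Fin (m + 1)) A)
    have h1 (b : Polynomial (MvPolynomial (Fin m) A)) (x : M) : b • x = e b • x := rfl
    have : IsScalarTower A (Polynomial (MvPolynomial (Fin m) A)) M :=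
      ⟨fun a b x => by rw [h1, h1, map_smul, smul_assoc]⟩
    exact RPD.transport e M (fun b x => rfl) (RPD.poly_step (m + 1) ih M)

end poly

/-- Prepend a type to a sequence of types. -/
def ConsT (P : Type u) (Q : ℕ → Type u) : ℕ → Type u
  | 0 => P
  | n + 1 => Q n

instance consGroup (P : Type u) (Q : ℕ → Type u) [h : AddCommGroup P]
    [h' : ∀ i, AddCommGroup (Q i)] : ∀ n, AddCommGroup (ConsT P Q n)
  | 0 => h
  | n + 1 => h' n

instance consModule (A : Type u) [Ring A] (P : Type u) (Q : ℕ → Type u) [AddCommGroup P]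
    [∀ i, AddCommGroup (Q i)] [h : Module A P] [h' : ∀ i, Module A (Q i)] :
    ∀ n, Module A (ConsT P Q n)
  | 0 => h
  | n + 1 => h' n

instance consTower (A B : Type u) [CommRing A] [Ring B] [Algebra A B] (P : Type u)
    (Q : ℕ → Type u) [AddCommGroup P]
    [∀ i, AddCommGroup (Q i)] [Module A P] [∀ i, Module A (Q i)]
    [Module B P] [∀ i, Module B (Q i)] [h : IsScalarTower A B P]
    [h' : ∀ i, IsScalarTower A B (Q i)] :
    ∀ n, IsScalarTower A B (ConsT P Q n)
  | 0 => h
  | n + 1 => h' n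

theorem RPD.resolution {A B : Type u} [CommRing A] [Ring B] [Algebra A B] {d : ℕ} :
    ∀ (M : Type u) [AddCommGroup M] [Module A M] [Module B M] [IsScalarTower A B M],
    RPD A B d M →
    ∃ (P : ℕ → Type u) (_ : ∀ i, AddCommGroup (P i)) (_ : ∀ i, Module A (P i))
      (_ : ∀ i, Module B (P i))
      (_ : ∀ i, IsScalarTower A B (P i))
      (d' : ∀ i : ℕ, P (i + 1) →ₗ[B] P i)
      (ε : P 0 →ₗ[B] M),
      (∀ i, IsRelativelyProjective A B (P i)) ∧
      (∀ i, d ≤ i → Subsingleton (P i)) ∧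
      Function.Surjective ε ∧
      LinearMap.ker ε = LinearMap.range (d' 0) ∧
      (∀ i, LinearMap.ker (d' i) = LinearMap.range (d' (i + 1))) ∧
      (∃ s : M →ₗ[A] P 0, ∀ x : M, ε (s x) = x) ∧
      (∀ i, ∃ h : P i →ₗ[A] P (i + 1), ∀ x : P (i + 1), d' i (h (d' i x)) = d' i x) := by
  induction d with
  | zero =>
    intro M _ _ _ _ hM
    have : Subsingleton M := hM
    refine ⟨fun _ => PUnit, fun _ => inferInstance, fun _ => inferInstance,
      fun _ => inferInstance, fun _ => inferInstance, fun _ => 0, 0,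
      fun _ => relProj_of_subsingleton _, fun _ _ => inferInstance,
      fun x => ⟨0, Subsingleton.elim _ _⟩, Subsingleton.elim _ _, fun _ => Subsingleton.elim _ _,
      ⟨0, fun x => Subsingleton.elim _ _⟩, fun _ => ⟨0, fun x => Subsingleton.elim _ _⟩⟩
  | succ d ih =>
    intro M _ _ _ _ hM
    obtain ⟨K, P, _, _, _, _, _, _, _, _, i, q, hP, hK, S⟩ := hM
    obtain ⟨Q, iQ1, iQ2, iQ3, iQ4, dQ, ε, hQ, hsub, hε, hker, hkers, ⟨s, hs⟩, hh⟩ := ih K hK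
    obtain ⟨r, hr⟩ := S.exists_retraction
    obtain ⟨hi, hex, σ, hσ⟩ := S
    let δ : ∀ n, ConsT P Q (n + 1) →ₗ[B] ConsT P Q n
      | 0 => (i ∘ₗ ε : Q 0 →ₗ[B] P)
      | n + 1 => (dQ n : Q (n + 1) →ₗ[B] Q n)
    refine ⟨ConsT P Q, inferInstance, inferInstance, inferInstance, inferInstance, δ, q, ?_, ?_, fun x => ⟨σ x, hσ x⟩, ?_, ?_, ⟨σ, hσ⟩, ?_⟩
    · intro n; cases n; exacts [hP, hQ _]
    · intro n hn
      cases n with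
      | zero => omega
      | succ n => exact hsub n (by omega)
    · ext x
      change q x = 0 ↔ ∃ y, i (ε y) = x
      refine (hex x).trans ?_
      constructor
      · rintro ⟨y, rfl⟩
        obtain ⟨z, rfl⟩ := hε y
        exact ⟨z, rfl⟩
      · rintro ⟨y, rfl⟩
        exact ⟨_, rfl⟩
    · intro n
      cases n with
      | zero =>
        change LinearMap.ker (i ∘ₗ ε) = LinearMap.range (dQ 0)
        rw [← hker, LinearMap.ker_comp_of_ker_eq_bot _ (LinearMap.ker_eq_bot.2 hi)]
      | succ n => exact hkers n
    · intro n
      cases n with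
      | zero =>
        refine ⟨s ∘ₗ r, fun x => ?_⟩
        change i (ε (s (r (i (ε x))))) = i (ε x)
        rw [hs, hr]
        exact (hex _).2 ⟨_, rfl⟩
      | succ n => exact hh n

/-- **Hochschild.**  Every finitely generated module `M` over the polynomial
ring `S = A[x₀,…,xₙ]` over a commutative Noetherian ring `A` has a finite `A`-split
relatively projective resolution of length at most `n+1`.

The resolution is encoded as a family `P : ℕ → Type u` of relatively projective
`S`-modules with `P i` trivial for `i > n+1` (so the sequence reads
`0 → P_{n+1} → ⋯ → P₁ → P₀ → M → 0`), differentials `d i : P (i+1) → P i` and an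
augmentation `ε : P₀ → M`, which form an exact sequence of `S`-modules; the `A`-splitness
is encoded by an `A`-linear section of `ε` and `A`-linear maps `h i` with
`d i ∘ h i ∘ d i = d i` (equivalently: each surjection of a term onto its image and each
inclusion of a cycle submodule admits an `A`-linear splitting). -/
theorem hochschild_relatively_projective_resolution
    (A : Type u) [CommRing A] [IsNoetherianRing A] (n : ℕ)
    (M : Type u) [AddCommGroup M] [Module A M]
    [Module (MvPolynomial (Fin (n + 1)) A) M]
    [IsScalarTower A (MvPolynomial (Fin (n + 1)) A) M]
    [Module.Finite (MvPolynomial (Fin (n + 1)) A) M] :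
    ∃ (P : ℕ → Type u) (_ : ∀ i, AddCommGroup (P i)) (_ : ∀ i, Module A (P i))
      (_ : ∀ i, Module (MvPolynomial (Fin (n + 1)) A) (P i))
      (_ : ∀ i, IsScalarTower A (MvPolynomial (Fin (n + 1)) A) (P i))
      (d : ∀ i : ℕ, P (i + 1) →ₗ[MvPolynomial (Fin (n + 1)) A] P i)
      (ε : P 0 →ₗ[MvPolynomial (Fin (n + 1)) A] M),
      (∀ i, IsRelativelyProjective A (MvPolynomial (Fin (n + 1)) A) (P i)) ∧
      (∀ i, n + 1 < i → Subsingleton (P i)) ∧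
      Function.Surjective ε ∧
      LinearMap.ker ε = LinearMap.range (d 0) ∧
      (∀ i, LinearMap.ker (d i) = LinearMap.range (d (i + 1))) ∧
      (∃ s : M →ₗ[A] P 0, ∀ x : M, ε (s x) = x) ∧
      (∀ i, ∃ h : P i →ₗ[A] P (i + 1), ∀ x : P (i + 1), d i (h (d i x)) = d i x) := by

  obtain ⟨P, i1, i2, i3, i4, d, ε, h1, h2, h⟩ :=
    RPD.resolution M (RPD.mvPolynomial (A := A) (n + 1) M)
  exact ⟨P, i1, i2, i3, i4, d, ε, h1, fun i hi => h2 i hi, h⟩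
end

section
/- Let A be a commutative Noetherian ring and let 0 → M' → M → M'' → 0 be an exact sequence of finitely generated A-modules with M projective. If for every maximal ideal P of A the induced sequence after tensoring with A/P is exact (equivalently, the induced map M' ⊗_A A/P → M ⊗_A A/P is injective for every maximal ideal P), then the sequence 0 → M' → M → M'' → 0 is split exact, i.e., the injection M' → M admits an A-linear retraction. -/
open TensorProduct

universe u

/-- Let `A` be a commutative Noetherian ring and
`0 → M' → M → M'' → 0` an exact sequence of finitely generated `A`-modules with `M`
projective.  If for every maximal ideal `P` of `A` the map
`M' ⊗[A] A/P → M ⊗[A] A/P` induced by tensoring is injective (equivalently, the tensored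
sequence is exact), then the sequence is split exact: the injection `M' → M` admits an
`A`-linear retraction. -/
theorem split_of_fiberwise_exact
    (A : Type u) [CommRing A] [IsNoetherianRing A]
    (M' M M'' : Type u)
    [AddCommGroup M'] [Module A M'] [Module.Finite A M']
    [AddCommGroup M] [Module A M] [Module.Finite A M] [Module.Projective A M]
    [AddCommGroup M''] [Module A M''] [Module.Finite A M'']
    (f : M' →ₗ[A] M) (g : M →ₗ[A] M'')
    (hf : Function.Injective f) (hg : Function.Surjective g)
    (hfg : LinearMap.ker g = LinearMap.range f)
    (hfiber : ∀ P : Ideal A, P.IsMaximal →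
      Function.Injective (LinearMap.rTensor (A ⧸ P) f)) :
    ∃ r : M →ₗ[A] M', r ∘ₗ f = LinearMap.id := by
  let I : Ideal A :=
    { carrier := {s | ∃ r : M →ₗ[A] M', r ∘ₗ f = s • LinearMap.id}
      zero_mem' := ⟨0, by simp⟩
      add_mem' := by
        rintro a b ⟨r, hr⟩ ⟨t, ht⟩
        exact ⟨r + t, by rw [LinearMap.add_comp, hr, ht, add_smul]⟩
      smul_mem' := by
        rintro c a ⟨r, hr⟩
        exact ⟨c • r, by rw [LinearMap.smul_comp, hr, smul_smul, smul_eq_mul]⟩ }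
  suffices hI : I = ⊤ by
    have h1 : (1 : A) ∈ I := hI ▸ Submodule.mem_top
    obtain ⟨r, hr⟩ := h1
    exact ⟨r, by rw [hr, one_smul]⟩
  by_contra hI
  obtain ⟨P, hP, hIP⟩ := Ideal.exists_le_maximal I hI
  let _ : Field (A ⧸ P) := Ideal.Quotient.field P
  have hinj : Function.Injective (f.baseChange (A ⧸ P)) := by
    have := (LinearMap.lTensor_inj_iff_rTensor_inj (A ⧸ P) f).2 (hfiber P hP)
    exact this
  obtain ⟨t, ht⟩ := LinearMap.exists_leftInverse_of_injective (f.baseChange (A ⧸ P))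
    (LinearMap.ker_eq_bot.2 hinj)
  have hsurj : Function.Surjective (TensorProduct.mk A (A ⧸ P) M' 1) :=
    TensorProduct.mk_surjective A M' (A ⧸ P) Ideal.Quotient.mk_surjective
  obtain ⟨r, hr⟩ := Module.projective_lifting_property (TensorProduct.mk A (A ⧸ P) M' 1)
    ((t.restrictScalars A) ∘ₗ TensorProduct.mk A (A ⧸ P) M 1) hsurj
  have hker : ∀ x : M', (1 : A ⧸ P) ⊗ₜ[A] x = 0 → x ∈ P • (⊤ : Submodule A M') := by
    intro x hx
    have := congrArg (TensorProduct.quotTensorEquivQuotSMul M' P) hx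
    rw [map_zero, ← map_one (Ideal.Quotient.mk P),
      TensorProduct.quotTensorEquivQuotSMul_mk_tmul, one_smul] at this
    exact (Submodule.Quotient.mk_eq_zero _).1 this
  let h : Module.End A M' := 1 - r ∘ₗ f
  have hh : LinearMap.range h ≤ P • (⊤ : Submodule A M') := by
    rintro _ ⟨x, rfl⟩
    apply hker
    have e1 := LinearMap.congr_fun hr (f x)
    have e2 := LinearMap.congr_fun ht ((1 : A ⧸ P) ⊗ₜ[A] x)
    simp only [LinearMap.comp_apply, TensorProduct.mk_apply, LinearMap.restrictScalars_apply,
      LinearMap.baseChange_tmul, LinearMap.id_apply] at e1 e2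
    simp [h, TensorProduct.tmul_sub, e1, e2]
  obtain ⟨p, hpm, -, hpc, hp0⟩ :=
    LinearMap.exists_monic_and_natDegree_eq_and_coeff_mem_pow_and_aeval_eq_zero A h P hh
  obtain ⟨q, hq⟩ := Polynomial.X_sub_C_dvd_sub_C_eval (a := (1 : A)) (p := p)
  have hmem : p.eval 1 ∈ I := by
    refine ⟨Polynomial.aeval h q ∘ₗ r, ?_⟩
    have e := congrArg (Polynomial.aeval h) (hq.trans (mul_comm _ _))
    simp only [map_sub, map_mul, hp0, Polynomial.aeval_C, Polynomial.aeval_X, map_one,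
      zero_sub] at e
    have e3 : h - 1 = -(r ∘ₗ f) := by simp [h]
    rw [e3, mul_neg, neg_inj] at e
    rw [LinearMap.comp_assoc]
    refine e.symm.trans ?_
    rw [Algebra.algebraMap_eq_smul_one]
    rfl
  have hmem2 := hIP hmem
  apply hP.ne_top
  rw [Ideal.eq_top_iff_one]
  rw [Polynomial.eval_eq_sum_range, Finset.sum_range_succ] at hmem2
  simp only [one_pow, mul_one, hpm.coeff_natDegree] at hmem2
  refine (Submodule.add_mem_iff_right P (Submodule.sum_mem _ fun k hk => ?_)).1 hmem2
  have hk' := Finset.mem_range.1 hk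
  exact Ideal.pow_le_self (by omega) (hpc k)
end

section
/- Let A be a commutative Noetherian ring, let n ≥ 1, let S = A[x_0,…,x_n], and let I ⊆ S be an ideal that contains some power of each variable x_i (i.e., for each i there is m_i with x_i^{m_i} ∈ I). Then the canonical map S → Hom_S(I,S), sending s ∈ S to the homomorphism given by multiplication by s, is bijective; in other words, Hom_S(I,S) ≅ S via multiplication. -/
universe u

open MvPolynomial in
theorem aux_dvd {σ A : Type*} [CommRing A] {i j : σ} (hij : i ≠ j) (m k : ℕ)
    (p q : MvPolynomial σ A) (h : X j ^ k * p = X i ^ m * q) : X i ^ m ∣ p := by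
  classical
  rw [X_pow_eq_monomial, X_pow_eq_monomial] at h
  rw [X_pow_eq_monomial, monomial_one_dvd_iff_modMonomial_eq_zero]
  ext d
  rw [coeff_zero]
  by_cases hd : Finsupp.single i m ≤ d
  · exact coeff_modMonomial_of_le _ hd
  rw [coeff_modMonomial_of_not_le _ hd]
  have h1 := congrArg (coeff (Finsupp.single j k + d)) h
  rw [coeff_monomial_mul, one_mul, coeff_monomial_mul', if_neg] at h1
  · exact h1
  · intro hle
    apply hd
    rw [Finsupp.single_le_iff] at hle ⊢
    simpa [Finsupp.single_apply, hij.symm] using hle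

/-- Let `A` be a commutative Noetherian ring, `n ≥ 1`,
`S = A[x₀,…,xₙ]`, and `I ⊆ S` an ideal containing some power of each variable.  Then the
canonical map `S → Hom_S(I,S)` sending `s` to multiplication by `s` is bijective. -/
theorem hom_ideal_eq_ring
    (A : Type u) [CommRing A] [IsNoetherianRing A] (n : ℕ) (hn : 1 ≤ n)
    (I : Ideal (MvPolynomial (Fin (n + 1)) A))
    (hI : ∀ i : Fin (n + 1), ∃ m : ℕ, MvPolynomial.X i ^ m ∈ I) :
    Function.Bijective
      (fun s : MvPolynomial (Fin (n + 1)) A =>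
        (s • I.subtype :
          I →ₗ[MvPolynomial (Fin (n + 1)) A] MvPolynomial (Fin (n + 1)) A)) := by
  obtain ⟨m, hm⟩ := hI 0
  obtain ⟨k, hk⟩ := hI (Fin.last n)
  have h0 : (0 : Fin (n + 1)) ≠ Fin.last n := by
    intro h
    have := congrArg Fin.val h
    simp at this
    omega
  have hreg := (MvPolynomial.isRegular_X_pow (R := A) (n := (0 : Fin (n + 1))) m).left
  constructor
  · intro s t hst
    have := LinearMap.congr_fun hst ⟨_, hm⟩
    simp only [LinearMap.smul_apply, Submodule.subtype_apply, smul_eq_mul] at this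
    apply hreg
    simpa [mul_comm] using this
  · intro f
    have comm : ∀ x y : I, (x : MvPolynomial (Fin (n + 1)) A) * f y = y * f x := by
      intro x y
      rw [← smul_eq_mul, ← smul_eq_mul, ← map_smul, ← map_smul]
      congr 1
      ext1
      simp [mul_comm]
    obtain ⟨s, hs⟩ := aux_dvd h0 m k _ _ (comm ⟨_, hk⟩ ⟨_, hm⟩)
    refine ⟨s, ?_⟩
    ext1 y
    apply hreg
    have := comm ⟨_, hm⟩ y
    rw [hs] at this
    simp only [LinearMap.smul_apply, Submodule.subtype_apply, smul_eq_mul] at this ⊢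
    rw [this]
    ring
end

section
/- Let A be a commutative Noetherian ring, let n ≥ 1, let S = A[x_0,…,x_n], and let I ⊆ S be an ideal such that S/I is projective as an A-module and I contains some power of each variable x_i. Then Ext^i_S(S/I, S) = 0 for all 0 ≤ i ≤ n, and there is an isomorphism of A-modules Ext^{n+1}_S(S/I, S) ≅ Hom_A(S/I, A). -/
open CategoryTheory

universe u


section alg
open MvPolynomial
variable {A : Type u} [CommRing A] {σ : Type*} 

lemma aux_mem (m : ℕ) (s : Set σ) (f : MvPolynomial σ A) :
    f ∈ Ideal.span ((fun i => (X i : MvPolynomial σ A) ^ m) '' s) ↔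
      ∀ d ∈ f.support, ∃ i ∈ s, m ≤ d i := by
  have h := @mem_ideal_span_monomial_image σ A _ f ((fun i => Finsupp.single i m) '' s)
  rw [Set.image_image] at h
  simp only [X_pow_eq_monomial]
  rw [h]
  simp

lemma aux_reg (m : ℕ) (s : Set σ) (k : σ) (hk : k ∉ s) (f : MvPolynomial σ A)
    (h : (X k : MvPolynomial σ A) ^ m * f ∈
      Ideal.span ((fun i => (X i : MvPolynomial σ A) ^ m) '' s)) :
    f ∈ Ideal.span ((fun i => (X i : MvPolynomial σ A) ^ m) '' s) := by
  rw [aux_mem] at h ⊢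
  intro d hd
  obtain ⟨i, hi, hm⟩ := h (Finsupp.single k m + d) (by
    rw [mem_support_iff, X_pow_eq_monomial, coeff_monomial_mul, one_mul]
    exact mem_support_iff.1 hd)
  refine ⟨i, hi, ?_⟩
  have : k ≠ i := by rintro rfl; exact hk hi
  simpa [Finsupp.single_apply, this] using hm

lemma aux_wreg (m N : ℕ) :
    RingTheory.Sequence.IsWeaklyRegular (MvPolynomial (Fin N) A)
      (List.ofFn fun i : Fin N => (X i : MvPolynomial (Fin N) A) ^ m) := by
  constructor
  intro i hi
  have hi' : i < N := by simpa using hi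
  have hJ : (Ideal.ofList ((List.ofFn fun i : Fin N => (X i : MvPolynomial (Fin N) A) ^ m).take i)
      • ⊤ : Submodule (MvPolynomial (Fin N) A) (MvPolynomial (Fin N) A)) =
      Ideal.span ((fun i => (X i : MvPolynomial (Fin N) A) ^ m) '' {j | j.val < i}) := by
    rw [smul_eq_mul, Ideal.mul_top, Ideal.ofList]
    congr 1
    ext x
    simp only [Set.mem_ofPred_eq, Set.mem_image, List.mem_take_iff_getElem]
    constructor
    · rintro ⟨j, hj, rfl⟩
      simp at hj
      exact ⟨⟨j, by omega⟩, by simpa using hj.1, by simp⟩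
    · rintro ⟨j, hj, rfl⟩
      exact ⟨j, by simp; omega, by simp⟩
  rw [hJ]
  rw [isSMulRegular_iff_right_eq_zero_of_smul]
  intro x
  obtain ⟨f, rfl⟩ := Submodule.Quotient.mk_surjective _ x
  rw [← Submodule.Quotient.mk_smul, Submodule.Quotient.mk_eq_zero, Submodule.Quotient.mk_eq_zero]
  intro h
  refine aux_reg m _ ⟨i, hi'⟩ (by simp) f ?_
  simpa using h

section top
variable {N : Type*} [AddCommGroup N] [Module (MvPolynomial σ A) N] [Module A N]
  [IsScalarTower A (MvPolynomial σ A) N] [Finite σ]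

lemma aux_top (m : ℕ) (hm : 0 < m) (hN : ∀ (i : σ) (y : N), (X i : MvPolynomial σ A) ^ m • y = 0)
    (J : Ideal (MvPolynomial σ A))
    (hJ : J = Ideal.span (Set.range fun i => (X i : MvPolynomial σ A) ^ m)) :
    ∃ e : (N →ₗ[MvPolynomial σ A] (MvPolynomial σ A ⧸ J)) ≃+ (N →ₗ[A] A),
      ∀ (a : A) x, e (algebraMap A (MvPolynomial σ A) a • x) = a • e x := by
  classical
  have := Fintype.ofFinite σ
  have hmem : ∀ f, f ∈ J ↔ ∀ d ∈ f.support, ∃ i, m ≤ d i := by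
    intro f
    rw [hJ, ← Set.image_univ, aux_mem]
    simp
  let t : σ →₀ ℕ := Finsupp.equivFunOnFinite.symm fun _ => m - 1
  have htle : ∀ d : σ →₀ ℕ, d ≤ t ↔ ∀ i, d i < m := by
    intro d
    rw [Finsupp.le_def]
    refine forall_congr' fun i => ?_
    simp only [t, Finsupp.equivFunOnFinite_symm_apply_apply]
    omega
  have hmem' : ∀ f, f ∈ J ↔ ∀ d ≤ t, coeff d f = 0 := by
    intro f
    rw [hmem]
    refine forall_congr' fun d => ?_
    rw [mem_support_iff, htle]
    constructor
    · intro h h'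
      by_contra h0
      obtain ⟨i, hi⟩ := h h0
      have := h' i
      omega
    · intro h h'
      by_contra! h0
      exact h' (h h0)
  let lam : (MvPolynomial σ A ⧸ J) →ₗ[A] A :=
    Submodule.liftQ (J.restrictScalars A) (lcoeff A t) (fun f hf => (hmem' f).1 hf t le_rfl)
  have hlam : ∀ f : MvPolynomial σ A, lam (Submodule.Quotient.mk f) = coeff t f := fun f => rfl
  have hmon : ∀ d ≤ t, ∀ f : MvPolynomial σ A,
      coeff t (monomial (t - d) (1 : A) * f) = coeff d f := by
    intro d hd f
    have : t = (t - d) + d := (tsub_add_cancel_of_le hd).symm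
    conv_lhs => rw [this]
    simp [coeff_monomial_mul]
  have hnd : ∀ q : MvPolynomial σ A ⧸ J,
      (∀ s : MvPolynomial σ A, lam (s • q) = 0) → q = 0 := by
    intro q hq
    obtain ⟨f, rfl⟩ := Submodule.Quotient.mk_surjective _ q
    rw [Submodule.Quotient.mk_eq_zero, hmem']
    intro d hd
    have := hq (monomial (t - d) 1)
    rw [← Submodule.Quotient.mk_smul, hlam, smul_eq_mul, hmon d hd] at this
    exact this
  let Φ : (N →ₗ[MvPolynomial σ A] (MvPolynomial σ A ⧸ J)) →+ (N →ₗ[A] A) :=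
    { toFun := fun φ => lam ∘ₗ φ.restrictScalars A
      map_zero' := by ext; simp
      map_add' := fun _ _ => by ext; simp }
  have hΦ : ∀ φ y, Φ φ y = lam (φ y) := fun _ _ => rfl
  refine ⟨AddEquiv.ofBijective Φ ⟨?_, ?_⟩, ?_⟩
  · rw [injective_iff_map_eq_zero]
    intro φ hφ
    ext y
    apply hnd
    intro s
    rw [← map_smul, ← hΦ, hφ]
    rfl
  · intro ψ
    let F : N → MvPolynomial σ A := fun y =>
      ∑ d ∈ Finset.Iic t, monomial d (ψ (monomial (t - d) (1 : A) • y))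
    have hF : ∀ y, ∀ d ≤ t, coeff d (F y) = ψ (monomial (t - d) (1 : A) • y) := by
      intro y d hd
      simp only [F, coeff_sum, coeff_monomial]
      rw [Finset.sum_ite_eq' , if_pos (by simpa using hd)]
    have hkill : ∀ d : σ →₀ ℕ, ¬ d ≤ t → ∀ y : N, monomial d (1 : A) • y = 0 := by
      intro d hd y
      rw [htle] at hd
      push Not at hd
      obtain ⟨i, hi⟩ := hd
      have : d = (d - Finsupp.single i m) + Finsupp.single i m :=
        (tsub_add_cancel_of_le (by simpa using hi)).symm
      rw [this, ← one_mul (1 : A), ← monomial_mul, mul_smul, ← X_pow_eq_monomial, hN, smul_zero]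
    have hkey : ∀ (s : MvPolynomial σ A) y,
        lam (s • (Submodule.Quotient.mk (F y) : MvPolynomial σ A ⧸ J)) = ψ (s • y) := by
      intro s y
      rw [← Submodule.Quotient.mk_smul, hlam, smul_eq_mul]
      induction s using MvPolynomial.induction_on' with
      | add p q hp hq => rw [add_mul, coeff_add, hp, hq, add_smul, map_add]
      | monomial d a =>
        have h1 : (monomial d a : MvPolynomial σ A) = a • monomial d 1 := by
          simp [smul_monomial]
        rw [h1, smul_mul_assoc, coeff_smul, smul_assoc, map_smul]
        congr 1
        by_cases hd : d ≤ t
        · have h2 : d = t - (t - d) := (tsub_tsub_cancel_of_le hd).symm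
          conv_lhs => rw [h2]
          rw [hmon _ tsub_le_self, hF _ _ tsub_le_self, ← h2]
        · rw [hkill d hd, map_zero, coeff_monomial_mul', if_neg hd]
    let φ : N →ₗ[MvPolynomial σ A] (MvPolynomial σ A ⧸ J) :=
      { toFun := fun y => Submodule.Quotient.mk (F y)
        map_add' := fun x y => by
          rw [← sub_eq_zero]
          apply hnd
          intro s
          rw [smul_sub, smul_add, map_sub, map_add, hkey, hkey, hkey, smul_add, map_add, sub_self]
        map_smul' := fun r y => by
          rw [← sub_eq_zero]
          apply hnd
          intro s
          rw [smul_sub, map_sub, RingHom.id_apply, ← mul_smul, hkey, hkey, mul_smul, sub_self] }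
    refine ⟨φ, ?_⟩
    ext y
    rw [hΦ]
    have := hkey 1 y
    rw [one_smul, one_smul] at this
    exact this
  · intro a x
    ext y
    change lam ((algebraMap A (MvPolynomial σ A) a • x) y) = a • lam (x y)
    rw [LinearMap.smul_apply, algebraMap_smul, map_smul]

end top
end alg

section rees
open Abelian RingTheory.Sequence
variable {S : Type u} [CommRing S]

lemma aux_shift0 (N : ModuleCat.{u} S) (T : ShortComplex (ModuleCat.{u} S)) (hS : T.ShortExact)
    (hT : ∀ i, ∀ x : Abelian.Ext N T.X₁ i, x.comp (Ext.mk₀ T.f) (add_zero _) = 0)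
    (i : ℕ) (h0 : Subsingleton (Abelian.Ext N T.X₂ i)) :
    Nonempty (Abelian.Ext N T.X₁ (i+1) ≃ₗ[S] Abelian.Ext N T.X₃ i) := by
  let φ : Abelian.Ext N T.X₃ i →ₗ[S] Abelian.Ext N T.X₁ (i+1) :=
    { toFun := fun x => x.comp hS.extClass rfl
      map_add' := fun x y => by simp
      map_smul' := fun r x => by simp }
  refine ⟨(LinearEquiv.ofBijective φ ⟨?_, ?_⟩).symm⟩
  · rw [injective_iff_map_eq_zero]
    intro x hx
    obtain ⟨y, rfl⟩ := Ext.covariant_sequence_exact₃ N hS x rfl hx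
    have : y = 0 := Subsingleton.elim _ _
    subst this
    simp
  · intro x
    exact Ext.covariant_sequence_exact₁ N hS x (hT _ x) rfl

lemma aux_kill (N M : ModuleCat.{u} S) (a : S) (hN : a ∈ Module.annihilator S N) (i : ℕ)
    (x : Abelian.Ext N M i) : x.comp (Ext.mk₀ (a • 𝟙 M)) (add_zero i) = 0 := by
  have h : a • 𝟙 N = 0 := by
    simp [← ModuleCat.lsmul_eq_smul_id, Module.mem_annihilator_iff_lsmul_eq_zero.mp hN]
  have h2 : a • x = (Ext.mk₀ (a • 𝟙 N)).comp x (zero_add i) := by simp [Ext.mk₀_smul]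
  rw [← Ext.smul_eq_comp_mk₀, h2, h]
  simp

lemma aux_shift1 (N M Q : ModuleCat.{u} S) (a : S) (hN : a ∈ Module.annihilator S N)
    (g : M ⟶ Q) (w : (a • 𝟙 M) ≫ g = 0) (hS : (ShortComplex.mk (a • 𝟙 M) g w).ShortExact)
    (i : ℕ) (h0 : Subsingleton (Abelian.Ext N M i)) :
    Nonempty (Abelian.Ext N M (i+1) ≃ₗ[S] Abelian.Ext N Q i) := by
  refine aux_shift0 N _ hS ?_ i h0
  intro i x
  exact aux_kill N M a hN i x

lemma aux_shift (N M : ModuleCat.{u} S) (a : S) (ha : IsSMulRegular M a)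
    (hN : a ∈ Module.annihilator S N) (i : ℕ) (h0 : Subsingleton (Abelian.Ext N M i)) :
    Nonempty (Abelian.Ext N M (i+1) ≃ₗ[S] Abelian.Ext N (ModuleCat.of S (QuotSMulTop a M)) i) :=
  aux_shift1 N M _ a hN (M.smulShortComplex a).g (M.smulShortComplex a).zero
    ha.smulShortComplex_shortExact i h0

lemma aux_rees0 (N M : ModuleCat.{u} S) (a : S) (ha : IsSMulRegular M a)
    (hN : a ∈ Module.annihilator S N) : Subsingleton (Abelian.Ext N M 0) := by
  refine (Ext.addEquiv₀.trans ModuleCat.homAddEquiv).subsingleton_congr.2 ⟨fun f g => ?_⟩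
  ext y
  apply ha
  change a • _ = a • _
  rw [← map_smul, ← map_smul, Module.mem_annihilator.1 hN y]
  simp

lemma aux_rees (N : ModuleCat.{u} S) (rs : List S) : ∀ (M : ModuleCat.{u} S)
    (_ : IsWeaklyRegular M rs) (_ : ∀ r ∈ rs, r ∈ Module.annihilator S N),
    (∀ i < rs.length, Subsingleton (Abelian.Ext N M i)) ∧
    Nonempty (Abelian.Ext N M rs.length ≃ₗ[S]
      (N →ₗ[S] (M ⧸ (Ideal.ofList rs • ⊤ : Submodule S M)))) := by
  induction rs with
  | nil =>
    intro M _ _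
    refine ⟨by simp, ⟨Ext.linearEquiv₀ (R := S) ≪≫ₗ ModuleCat.homLinearEquiv (S := S) ≪≫ₗ
      LinearEquiv.congrRight (Submodule.quotEquivOfEqBot _ (by simp)).symm⟩⟩
  | cons a rs ih =>
    intro M hM hN
    rw [isWeaklyRegular_cons_iff] at hM
    obtain ⟨h1, ⟨e⟩⟩ := ih (ModuleCat.of S (QuotSMulTop a M)) hM.2
      (fun r hr => hN r (List.mem_cons_of_mem _ hr))
    have ha := hN a List.mem_cons_self
    have key : ∀ i < (a :: rs).length, Subsingleton (Abelian.Ext N M i) := by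
      intro i
      induction i with
      | zero => intro _; exact aux_rees0 N M a hM.1 ha
      | succ i hi =>
        intro h
        obtain ⟨e'⟩ := aux_shift N M a hM.1 ha i (hi (by omega))
        have := h1 i (by simpa using h)
        exact e'.toEquiv.subsingleton
    refine ⟨key, ?_⟩
    obtain ⟨e'⟩ := aux_shift N M a hM.1 ha rs.length (key _ (by simp))
    exact ⟨e' ≪≫ₗ e ≪≫ₗ LinearEquiv.congrRight
      (Submodule.quotOfListConsSMulTopEquivQuotSMulTopInner M a rs).symm⟩

end rees

section bridge
variable {S : Type u} [CommRing S]

lemma bridge0 (N M : ModuleCat.{u} S) (h : Subsingleton (Abelian.Ext N M 0)) :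
    Subsingleton (((Ext S (ModuleCat.{u} S) 0).obj (Opposite.op N)).obj M) := by
  have hNM : ∀ f : N ⟶ M, f = 0 := fun f =>
    Abelian.Ext.addEquiv₀.symm.injective (Subsingleton.elim _ _)
  let P := projectiveResolution N
  have e := P.isoExt (R := S) 0 M
  refine ((e ≪≫ ShortComplex.moduleCatHomologyIso _).toLinearEquiv.toEquiv).subsingleton_congr.2 ?_
  have : Subsingleton (LinearMap.ker ((P.complex.linearYonedaObj S M).sc 0).g.hom) := by
    rw [Submodule.subsingleton_iff_eq_bot, LinearMap.ker_eq_bot']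
    intro f hf
    have hf1 : ((P.complex.linearYonedaObj S M).d 0 1).hom f = 0 := by
      have hn : (ComplexShape.up ℕ).next 0 = 1 := by simp
      have : ∀ j, (ComplexShape.up ℕ).next 0 = j →
        ((P.complex.linearYonedaObj S M).d 0 j).hom f = 0 := by
        rintro _ rfl
        exact hf
      exact this 1 hn
    have hf2 : P.complex.d 1 0 ≫ (show P.complex.X 0 ⟶ M from f) = 0 := hf1
    have := P.exact₀.g_desc (show P.complex.X 0 ⟶ M from f) hf2
    have h0 : P.exact₀.desc _ hf2 = 0 := hNM _
    rw [h0, Limits.comp_zero] at this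
    exact this.symm
  exact (Submodule.mkQ_surjective _).subsingleton

lemma bridge (N M : ModuleCat.{u} S) (n : ℕ) :
    Nonempty ((((Ext S (ModuleCat.{u} S) (n+1)).obj (Opposite.op N)).obj M) ≃ₗ[S]
      Abelian.Ext N M (n+1)) := by
  let P := projectiveResolution N
  let K := P.complex.linearYonedaObj S M
  have e := P.isoExt (R := S) (n+1) M ≪≫ (ShortComplex.homologyMapIso (K.isoSc' n (n+1) (n+2) (by simp) (by simp))) ≪≫ ShortComplex.moduleCatHomologyIso _
  have hd : ∀ f : LinearMap.ker (K.sc' n (n+1) (n+2)).g.hom, 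
    P.complex.d (n+2) (n+1) ≫ (show P.complex.X (n+1) ⟶ M from f.1) = 0 := fun f => f.2
  let φ : LinearMap.ker (K.sc' n (n+1) (n+2)).g.hom →ₗ[S] Abelian.Ext N M (n+1) :=
    { toFun := fun f => P.extMk (show P.complex.X (n+1) ⟶ M from f.1) (n+2) rfl (hd f)
      map_add' := fun x y => by
        rw [ProjectiveResolution.add_extMk]; rfl
      map_smul' := fun r x => by
        have := P.extMk_comp_mk₀ (show P.complex.X (n+1) ⟶ M from x.1) (n+2) rfl (hd x) (r • 𝟙 M)
        refine Eq.trans ?_ (this.symm.trans (Abelian.Ext.smul_eq_comp_mk₀ _ _).symm)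
        have h2 : ((show P.complex.X (n+1) ⟶ M from x.1) ≫ (r • 𝟙 M)) =
          r • (show P.complex.X (n+1) ⟶ M from x.1) := by
          rw [Linear.comp_smul, Category.comp_id]
        have h3 : ∀ (g g' : P.complex.X (n+1) ⟶ M) (h : g = g') hg hg', P.extMk g (n+2) rfl hg =
          P.extMk g' (n+2) rfl hg' := by
          rintro g _ rfl _ _; rfl
        exact h3 _ _ h2.symm _ _ }
  have hφ : Function.Surjective φ := by
    intro x
    obtain ⟨f, hf, rfl⟩ := P.extMk_surjective x (n+2) rfl
    exact ⟨⟨f, hf⟩, rfl⟩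
  have hk : LinearMap.ker φ = LinearMap.range (K.sc' n (n+1) (n+2)).moduleCatToCycles := by
    ext f
    rw [LinearMap.mem_ker, LinearMap.mem_range]
    refine (P.extMk_eq_zero_iff _ _ rfl (hd f) n rfl).trans ?_
    constructor
    · rintro ⟨g, hg⟩
      exact ⟨g, Subtype.ext hg⟩
    · rintro ⟨g, hg⟩
      exact ⟨g, congrArg Subtype.val hg⟩
  exact ⟨e.toLinearEquiv ≪≫ₗ (Submodule.quotEquivOfEq _ _ hk.symm) ≪≫ₗ φ.quotKerEquivOfSurjective hφ⟩
end bridge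
/-- Let `A` be a commutative Noetherian ring, `n ≥ 1`,
`S = A[x₀,…,xₙ]`, and `I ⊆ S` an ideal such that `S/I` is projective as an `A`-module and
`I` contains some power of each variable.  Then `Ext^i_S(S/I, S) = 0` for `0 ≤ i ≤ n`, and
`Ext^{n+1}_S(S/I, S) ≅ Hom_A(S/I, A)` as `A`-modules (the `A`-module structure on the Ext
group coming from the `S`-module structure via `A → S`). -/
theorem ext_quotient_vanishing_and_top
    (A : Type u) [CommRing A] [IsNoetherianRing A] (n : ℕ) (hn : 1 ≤ n)
    (I : Ideal (MvPolynomial (Fin (n + 1)) A))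
    (hproj : Module.Projective A (MvPolynomial (Fin (n + 1)) A ⧸ I))
    (hI : ∀ i : Fin (n + 1), ∃ m : ℕ, MvPolynomial.X i ^ m ∈ I) :
    (∀ i : ℕ, i ≤ n →
      Subsingleton
        (((Ext (MvPolynomial (Fin (n + 1)) A)
              (ModuleCat (MvPolynomial (Fin (n + 1)) A)) i).obj
            (Opposite.op
              (ModuleCat.of (MvPolynomial (Fin (n + 1)) A)
                (MvPolynomial (Fin (n + 1)) A ⧸ I)))).obj
          (ModuleCat.of (MvPolynomial (Fin (n + 1)) A) (MvPolynomial (Fin (n + 1)) A)))) ∧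
    ∃ e : (((Ext (MvPolynomial (Fin (n + 1)) A)
              (ModuleCat (MvPolynomial (Fin (n + 1)) A)) (n + 1)).obj
            (Opposite.op
              (ModuleCat.of (MvPolynomial (Fin (n + 1)) A)
                (MvPolynomial (Fin (n + 1)) A ⧸ I)))).obj
          (ModuleCat.of (MvPolynomial (Fin (n + 1)) A) (MvPolynomial (Fin (n + 1)) A)))
          ≃+ ((MvPolynomial (Fin (n + 1)) A ⧸ I) →ₗ[A] A),
      ∀ (a : A) (x), e (algebraMap A (MvPolynomial (Fin (n + 1)) A) a • x) = a • e x := by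
  have : ∃ m : ℕ, 0 < m ∧ ∀ i : Fin (n + 1), (MvPolynomial.X i : MvPolynomial (Fin (n + 1)) A) ^ m ∈ I := by
    choose k hk using hI
    refine ⟨1 + ∑ i, k i, by omega, fun i => ?_⟩
    have : k i ≤ 1 + ∑ i, k i :=
      (Finset.single_le_sum (f := k) (fun _ _ => Nat.zero_le _) (Finset.mem_univ i)).trans (by omega)
    exact I.pow_mem_of_pow_mem (hk i) this
  obtain ⟨m, hm, hI'⟩ := this
  have hkill : ∀ (i : Fin (n + 1)) (y : MvPolynomial (Fin (n + 1)) A ⧸ I),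
      (MvPolynomial.X i : MvPolynomial (Fin (n + 1)) A) ^ m • y = 0 := by
    intro i y
    obtain ⟨f, rfl⟩ := Submodule.Quotient.mk_surjective _ y
    rw [← Submodule.Quotient.mk_smul, Submodule.Quotient.mk_eq_zero]
    exact I.mul_mem_right _ (hI' i)
  have hann : ∀ r ∈ List.ofFn fun i : Fin (n + 1) =>
      (MvPolynomial.X i : MvPolynomial (Fin (n + 1)) A) ^ m,
      r ∈ Module.annihilator (MvPolynomial (Fin (n + 1)) A)
        (ModuleCat.of (MvPolynomial (Fin (n + 1)) A) (MvPolynomial (Fin (n + 1)) A ⧸ I)) := by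
    intro r hr
    rw [List.mem_ofFn] at hr
    obtain ⟨i, rfl⟩ := hr
    exact Module.mem_annihilator.2 (hkill i)
  obtain ⟨h1, ⟨e⟩⟩ := aux_rees
    (ModuleCat.of (MvPolynomial (Fin (n + 1)) A) (MvPolynomial (Fin (n + 1)) A ⧸ I)) _
    (ModuleCat.of (MvPolynomial (Fin (n + 1)) A) (MvPolynomial (Fin (n + 1)) A))
    (aux_wreg m (n + 1)) hann
  rw [List.length_ofFn] at h1 e
  refine ⟨fun i hi => ?_, ?_⟩
  · have h := h1 i (by omega)
    cases i with
    | zero => exact bridge0 _ _ h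
    | succ i =>
      obtain ⟨e'⟩ := bridge (ModuleCat.of (MvPolynomial (Fin (n + 1)) A)
        (MvPolynomial (Fin (n + 1)) A ⧸ I))
        (ModuleCat.of (MvPolynomial (Fin (n + 1)) A) (MvPolynomial (Fin (n + 1)) A)) i
      exact e'.toEquiv.subsingleton
  · obtain ⟨e'⟩ := bridge (ModuleCat.of (MvPolynomial (Fin (n + 1)) A)
        (MvPolynomial (Fin (n + 1)) A ⧸ I))
        (ModuleCat.of (MvPolynomial (Fin (n + 1)) A) (MvPolynomial (Fin (n + 1)) A)) n
    obtain ⟨E, hE⟩ := aux_top (N := MvPolynomial (Fin (n + 1)) A ⧸ I) m hm hkill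
      (Ideal.ofList (List.ofFn fun i : Fin (n + 1) =>
        (MvPolynomial.X i : MvPolynomial (Fin (n + 1)) A) ^ m) • ⊤) (by
        rw [smul_eq_mul, Ideal.mul_top, Ideal.ofList]
        congr 1
        ext x
        exact List.mem_ofFn)
    refine ⟨(e' ≪≫ₗ e).toAddEquiv.trans E, fun a x => ?_⟩
    change E ((e' ≪≫ₗ e) (_ • x)) = a • E ((e' ≪≫ₗ e) x)
    rw [map_smul]
    exact hE a _
end

section
/- Let K be a field and let S = K[t][x_0,x_1,x_2,x_3] be a polynomial ring in five variables over K. Then the three polynomials x_0^3, x_1^3, x_0x_2^2 + x_1x_3^2 + t·x_2^3 form a regular sequence on S: x_0^3 is a nonzerodivisor on S, x_1^3 is a nonzerodivisor on S/(x_0^3), and x_0x_2^2 + x_1x_3^2 + t·x_2^3 is a nonzerodivisor on S/(x_0^3, x_1^3). -/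
open MvPolynomial

universe u

theorem aux_monomial_nzd {K : Type u} [Field K] (S : Set (Fin 5 →₀ ℕ)) (m : Fin 5 →₀ ℕ)
    (h : ∀ s ∈ S, ∀ i, s i ≠ 0 → m i = 0) (g : MvPolynomial (Fin 5) K)
    (hg : monomial m (1 : K) * g ∈ Ideal.span ((fun s => monomial s (1 : K)) '' S)) :
    g ∈ Ideal.span ((fun s => monomial s (1 : K)) '' S) := by
  rw [mem_ideal_span_monomial_image] at hg ⊢
  intro d hd
  obtain ⟨s, hs, hle⟩ := hg (m + d) (by
    rw [mem_support_iff, coeff_monomial_mul, one_mul]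
    exact mem_support_iff.mp hd)
  refine ⟨s, hs, fun i => ?_⟩
  by_cases h0 : s i = 0
  · simp [h0]
  · have h1 := hle i
    rw [Finsupp.add_apply, h s hs i h0, zero_add] at h1
    exact h1

/-- Let `K` be a field and `S = K[t,x₀,x₁,x₂,x₃]` (five variables; here
`t = X 0`, `x₀ = X 1`, `x₁ = X 2`, `x₂ = X 3`, `x₃ = X 4`).  Then
`x₀³, x₁³, x₀x₂² + x₁x₃² + t·x₂³` is a regular sequence on `S`:
`x₀³` is a nonzerodivisor on `S`, `x₁³` is a nonzerodivisor on `S/(x₀³)`, and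
`x₀x₂² + x₁x₃² + t·x₂³` is a nonzerodivisor on `S/(x₀³, x₁³)`. -/
theorem caviglia_family_regular_sequence (K : Type u) [Field K] :
    (∀ g : MvPolynomial (Fin 5) K, X 1 ^ 3 * g = 0 → g = 0) ∧
    (∀ g : MvPolynomial (Fin 5) K ⧸ Ideal.span {(X 1 ^ 3 : MvPolynomial (Fin 5) K)},
      Ideal.Quotient.mk (Ideal.span {(X 1 ^ 3 : MvPolynomial (Fin 5) K)}) (X 2 ^ 3) * g = 0
        → g = 0) ∧
    (∀ g : MvPolynomial (Fin 5) K ⧸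
        Ideal.span {(X 1 ^ 3 : MvPolynomial (Fin 5) K), X 2 ^ 3},
      Ideal.Quotient.mk (Ideal.span {(X 1 ^ 3 : MvPolynomial (Fin 5) K), X 2 ^ 3})
          (X 1 * X 3 ^ 2 + X 2 * X 4 ^ 2 + X 0 * X 3 ^ 3) * g = 0
        → g = 0) := by
  refine ⟨fun g hg => ?_, fun g hg => ?_, fun g hg => ?_⟩
  · exact (mul_eq_zero.mp hg).resolve_left (pow_ne_zero _ (X_ne_zero _))
  · obtain ⟨g, rfl⟩ := Ideal.Quotient.mk_surjective g
    rw [← map_mul, Ideal.Quotient.eq_zero_iff_mem] at hg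
    rw [Ideal.Quotient.eq_zero_iff_mem]
    have hI : ({(X 1 ^ 3 : MvPolynomial (Fin 5) K)} : Set _) =
        (fun s => monomial s (1 : K)) '' {Finsupp.single 1 3} := by
      rw [Set.image_singleton, X_pow_eq_monomial]
    rw [hI] at hg ⊢
    rw [X_pow_eq_monomial] at hg
    refine aux_monomial_nzd _ _ ?_ g hg
    intro s hs i hi
    rw [Set.mem_singleton_iff] at hs
    subst hs
    fin_cases i <;> simp_all
  · obtain ⟨g, rfl⟩ := Ideal.Quotient.mk_surjective g
    rw [← map_mul, Ideal.Quotient.eq_zero_iff_mem] at hg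
    rw [Ideal.Quotient.eq_zero_iff_mem]
    have hI : ({(X 1 ^ 3 : MvPolynomial (Fin 5) K), X 2 ^ 3} : Set _) =
        (fun s => monomial s (1 : K)) '' {Finsupp.single 1 3, Finsupp.single 2 3} := by
      rw [Set.image_pair, X_pow_eq_monomial, X_pow_eq_monomial]
    have ha : (X 1 ^ 3 : MvPolynomial (Fin 5) K) ∈
        Ideal.span {(X 1 ^ 3 : MvPolynomial (Fin 5) K), X 2 ^ 3} :=
      Ideal.subset_span (by simp)
    have hb : (X 2 ^ 3 : MvPolynomial (Fin 5) K) ∈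
        Ideal.span {(X 1 ^ 3 : MvPolynomial (Fin 5) K), X 2 ^ 3} :=
      Ideal.subset_span (by simp)
    have key : ∀ (I : Ideal (MvPolynomial (Fin 5) K)) (a b P Q v g : MvPolynomial (Fin 5) K),
        a ^ 3 ∈ I → b ^ 3 ∈ I → (a * P + b * Q + v) * g ∈ I → v ^ 5 * g ∈ I := by
      intro I a b P Q v g ha hb hg
      have e : v ^ 5 * g = (v ^ 4 - v ^ 3 * (a * P + b * Q) + v ^ 2 * (a * P + b * Q) ^ 2
            - v * (a * P + b * Q) ^ 3 + (a * P + b * Q) ^ 4) * ((a * P + b * Q + v) * g)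
          - ((a ^ 2 * P ^ 5 + 5 * a * b * P ^ 4 * Q + 10 * b ^ 2 * P ^ 3 * Q ^ 2) * g * a ^ 3
            + (10 * a ^ 2 * P ^ 2 * Q ^ 3 + 5 * a * b * P * Q ^ 4 + b ^ 2 * Q ^ 5) * g * b ^ 3) := by
        ring
      rw [e]
      exact I.sub_mem (I.mul_mem_left _ hg)
        (I.add_mem (I.mul_mem_left _ ha) (I.mul_mem_left _ hb))
    have h5 := key _ _ _ _ _ _ _ ha hb hg
    have hm : ((X 0 * X 3 ^ 3) ^ 5 : MvPolynomial (Fin 5) K) =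
        monomial (Finsupp.single 0 5 + Finsupp.single 3 15) 1 := by
      rw [← mul_one (1 : K), ← monomial_mul, ← X_pow_eq_monomial, ← X_pow_eq_monomial]
      ring
    rw [hm, hI] at h5
    rw [hI]
    refine aux_monomial_nzd _ _ ?_ g h5
    intro s hs i hi
    rcases hs with rfl | rfl <;> fin_cases i <;> simp_all
end

section
/- Let K be a field, let E = Λ(e,f) be the exterior algebra over K on a 2-dimensional vector space with basis e, f, and for each m ≥ 1 let C^m be the (m+1) × m Toeplitz matrix over E with e on the main diagonal, f immediately below it, and zeros elsewhere. Then for every ℓ ≥ 1 the sequence E^ℓ → E^{ℓ+1} → E^{ℓ+2}, where the maps send a column vector v to C^ℓ·v and w to C^{ℓ+1}·w respectively (entries multiplied on the left in E), is exact at E^{ℓ+1}: the kernel of w ↦ C^{ℓ+1}·w equals the image of v ↦ C^ℓ·v. -/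
universe u

/-- The `(m+1) × m` Toeplitz matrix over the exterior algebra `E = Λ(e,f)` with `e` on the
main diagonal, `f` immediately below it, and zeros elsewhere. -/
noncomputable def toeplitzC (K : Type u) [Field K] (m : ℕ) :
    Matrix (Fin (m + 1)) (Fin m) (ExteriorAlgebra K (Fin 2 → K)) := fun i j =>
  if (i : ℕ) = (j : ℕ) then ExteriorAlgebra.ι K (Pi.single 0 1)
  else if (i : ℕ) = (j : ℕ) + 1 then ExteriorAlgebra.ι K (Pi.single 1 1)
  else 0

section ToeplitzAux

variable (K : Type u) [Field K]

noncomputable def tE : ExteriorAlgebra K (Fin 2 → K) := ExteriorAlgebra.ι K (Pi.single 0 1)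
noncomputable def tF : ExteriorAlgebra K (Fin 2 → K) := ExteriorAlgebra.ι K (Pi.single 1 1)

theorem tE_sq : tE K * tE K = 0 := ExteriorAlgebra.ι_sq_zero _
theorem tF_sq : tF K * tF K = 0 := ExteriorAlgebra.ι_sq_zero _
theorem tF_tE : tF K * tE K = -(tE K * tF K) :=
  eq_neg_of_add_eq_zero_left (ExteriorAlgebra.ι_add_mul_swap _ _)

noncomputable def tphiLin : (Fin 2 → K) →ₗ[K] QuaternionAlgebra K 0 0 0 where
  toFun v := ⟨0, v 0, v 1, 0⟩
  map_add' x y := by ext <;> simp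
  map_smul' c x := by ext <;> simp

noncomputable def tphi : ExteriorAlgebra K (Fin 2 → K) →ₐ[K] QuaternionAlgebra K 0 0 0 :=
  ExteriorAlgebra.lift K ⟨tphiLin K, fun v => by ext <;> simp [tphiLin] <;> ring⟩

theorem tphi_E : tphi K (tE K) = ⟨0, 1, 0, 0⟩ := by
  simp [tphi, tE, tphiLin]
theorem tphi_F : tphi K (tF K) = ⟨0, 0, 1, 0⟩ := by
  simp [tphi, tF, tphiLin]

noncomputable def tmk (a b c d : K) : ExteriorAlgebra K (Fin 2 → K) :=
  a • 1 + b • tE K + c • tF K + d • (tE K * tF K)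

theorem tphi_mk (a b c d : K) : tphi K (tmk K a b c d) = ⟨a, b, c, d⟩ := by
  simp only [tmk, map_add, map_smul, map_mul, map_one, tphi_E, tphi_F]
  ext <;> simp

theorem tmk_zero {a b c d : K} (h : tmk K a b c d = 0) : a = 0 ∧ b = 0 ∧ c = 0 ∧ d = 0 := by
  have := tphi_mk K a b c d
  rw [h, map_zero, QuaternionAlgebra.ext_iff] at this
  simpa [eq_comm] using this

theorem tE_mk (a b c d : K) : tE K * tmk K a b c d = tmk K 0 a 0 c := by
  simp [tmk, mul_add, ← mul_assoc, tE_sq]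

theorem tF_mk (a b c d : K) : tF K * tmk K a b c d = tmk K 0 0 a (-b) := by
  simp [tmk, mul_add, ← mul_assoc, tE_sq, tF_sq, tF_tE]
  simp [mul_assoc, tF_sq]

theorem tmk_add (a b c d a' b' c' d' : K) :
    tmk K a b c d + tmk K a' b' c' d' = tmk K (a+a') (b+b') (c+c') (d+d') := by
  simp only [tmk, add_smul]; abel

theorem tmk_ex (x : ExteriorAlgebra K (Fin 2 → K)) : ∃ a b c d, tmk K a b c d = x := by
  induction x using ExteriorAlgebra.induction with
  | algebraMap r => exact ⟨r, 0, 0, 0, by simp [tmk, Algebra.algebraMap_eq_smul_one]⟩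
  | ι v =>
    refine ⟨0, v 0, v 1, 0, ?_⟩
    have hv : v = v 0 • Pi.single 0 1 + v 1 • Pi.single 1 1 := by
      ext i; fin_cases i <;> simp
    conv_rhs => rw [hv]
    simp [tmk, tE, tF]
  | mul x y hx hy =>
    obtain ⟨a, b, c, d, rfl⟩ := hx
    obtain ⟨a', b', c', d', rfl⟩ := hy
    have h : tmk K a b c d * tmk K a' b' c' d' =
        a • tmk K a' b' c' d' + b • (tE K * tmk K a' b' c' d') + c • (tF K * tmk K a' b' c' d')
          + d • (tE K * (tF K * tmk K a' b' c' d')) := by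
      conv_lhs => rw [tmk]
      simp only [add_mul, smul_mul_assoc, one_mul, mul_assoc]
    have hs : ∀ r a b c d : K, r • tmk K a b c d = tmk K (r*a) (r*b) (r*c) (r*d) := by
      intro r a b c d
      simp only [tmk, smul_add, mul_smul]
    rw [h, tF_mk, tE_mk, tE_mk]
    simp only [hs, tmk_add]
    exact ⟨_, _, _, _, rfl⟩
  | add x y hx hy =>
    obtain ⟨a, b, c, d, rfl⟩ := hx
    obtain ⟨a', b', c', d', rfl⟩ := hy
    exact ⟨_, _, _, _, (tmk_add K ..).symm⟩

theorem t_row (m : ℕ) (V : ℕ → ExteriorAlgebra K (Fin 2 → K)) (hV : ∀ n, m ≤ n → V n = 0)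
    (i : Fin (m+1)) : (toeplitzC K m).mulVec (fun j => V j) i =
      tE K * V i + if (i : ℕ) = 0 then 0 else tF K * V (i - 1) := by
  have h1 : (toeplitzC K m).mulVec (fun j => V j) i =
      ∑ j : Fin m, ((if (i:ℕ) = (j:ℕ) then tE K * V j else 0) +
        (if (i:ℕ) = (j:ℕ) + 1 then tF K * V j else 0)) := by
    simp only [Matrix.mulVec, dotProduct, toeplitzC]
    refine Finset.sum_congr rfl fun j _ => ?_
    by_cases h : (i:ℕ) = j
    · have : ¬ ((i:ℕ) = j + 1) := by omega
      rw [if_pos h, if_pos h, if_neg this, add_zero]; rfl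
    · rw [if_neg h, if_neg h, zero_add]
      split_ifs
      · rfl
      · exact zero_mul _
  rw [h1, Fin.sum_univ_eq_sum_range (fun j => (if (i:ℕ) = j then tE K * V j else 0) +
        (if (i:ℕ) = j + 1 then tF K * V j else 0)) m, Finset.sum_add_distrib]
  congr 1
  · rw [Finset.sum_ite_eq]
    split_ifs with h
    · rfl
    · rw [hV _ (by simpa using h), mul_zero]
  · obtain ⟨i, hi⟩ := i
    rcases i with _ | i
    · simp
    · simp only [Nat.add_right_cancel_iff]
      rw [Finset.sum_ite_eq]
      simp; omega

theorem t_ext (m : ℕ) (w : Fin m → ExteriorAlgebra K (Fin 2 → K)) :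
    ∃ W : ℕ → ExteriorAlgebra K (Fin 2 → K), (∀ n, m ≤ n → W n = 0) ∧ w = fun j : Fin m => W j :=
  ⟨fun n => if h : n < m then w ⟨n, h⟩ else 0, fun n h => by simp [h], by ext j; simp⟩

end ToeplitzAux

/-- For every `ℓ ≥ 1` the sequence `E^ℓ → E^{ℓ+1} → E^{ℓ+2}` given by
left multiplication by the Toeplitz matrices `C^ℓ` and `C^{ℓ+1}` is exact at `E^{ℓ+1}`:
the kernel of `w ↦ C^{ℓ+1}·w` equals the image of `v ↦ C^ℓ·v`. -/
theorem toeplitzC_exact (K : Type u) [Field K] (ℓ : ℕ) (hℓ : 1 ≤ ℓ) :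
    ∀ w : Fin (ℓ + 1) → ExteriorAlgebra K (Fin 2 → K),
      (toeplitzC K (ℓ + 1)).mulVec w = 0 ↔
        ∃ v : Fin ℓ → ExteriorAlgebra K (Fin 2 → K), (toeplitzC K ℓ).mulVec v = w := by
  intro w
  constructor
  · intro hw
    obtain ⟨W, hW, rfl⟩ := t_ext K _ w
    choose a b c d hx using fun n => tmk_ex K (W n)
    have h0 : a 0 = 0 ∧ c 0 = 0 := by
      have := congrFun hw 0
      rw [t_row K _ W hW] at this
      simp only [Fin.val_zero, if_true, add_zero, Pi.zero_apply, ← hx, tE_mk] at this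
      have := tmk_zero K this
      tauto
    have hs : ∀ n, n < ℓ + 1 → a n = 0 ∧ c (n+1) = b n := by
      intro n hn
      have := congrFun hw ⟨n+1, by omega⟩
      rw [t_row K _ W hW] at this
      simp only [Nat.add_eq_zero_iff, one_ne_zero, and_false, if_false, Nat.add_sub_cancel,
        Pi.zero_apply, ← hx, tE_mk, tF_mk, tmk_add] at this
      obtain ⟨-, -, h1, h2⟩ := tmk_zero K this
      exact ⟨by simpa using h1, by linear_combination h2⟩
    have hb : b ℓ = 0 := by
      rw [← (hs ℓ (by omega)).2]
      have := hx (ℓ+1)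
      rw [hW _ le_rfl] at this
      exact (tmk_zero K this).2.2.1
    let V : ℕ → ExteriorAlgebra K (Fin 2 → K) := fun n =>
      if n < ℓ then tmk K (b n) (if n + 1 = ℓ then - d ℓ else 0) (d n) 0 else tmk K 0 0 0 0
    have hV : ∀ n, ℓ ≤ n → V n = 0 := by
      intro n hn
      simp [V, Nat.not_lt.mpr hn, tmk]
    refine ⟨fun j => V j, ?_⟩
    ext1 i
    rw [t_row K _ V hV]
    obtain ⟨i, hi⟩ := i
    rcases i with _ | n
    · simp only [if_true, add_zero, V, ← hx, h0]
      rw [if_pos (by omega), tE_mk]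
    · simp only [Nat.add_eq_zero_iff, one_ne_zero, and_false, if_false, Nat.add_sub_cancel, V, ← hx]
      rw [if_pos (show n < ℓ by omega), tF_mk, (hs (n+1) hi).1, (hs n (by omega)).2]
      by_cases h : n + 1 = ℓ
      · subst h
        simp [tE_mk, tmk_add, hb]
      · rw [if_pos (by omega), tE_mk, tmk_add, if_neg h]
        simp
  · rintro ⟨v, rfl⟩
    rw [Matrix.mulVec_mulVec]
    have : toeplitzC K (ℓ+1) * toeplitzC K ℓ = 0 := by
      ext i j
      have hc : ∀ k : Fin (ℓ+1), toeplitzC K ℓ k j = (fun n : ℕ => if n = (j:ℕ) then tE K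
        else if n = (j:ℕ)+1 then tF K else 0) k := fun k => rfl
      have := t_row K (ℓ+1) (fun n : ℕ => if n = (j:ℕ) then tE K
        else if n = (j:ℕ)+1 then tF K else 0) (fun n hn => by
          have := j.2
          rw [if_neg (by omega), if_neg (by omega)]) i
      simp only [← hc] at this
      refine Eq.trans this ?_
      obtain ⟨i, hi⟩ := i
      rcases i with _ | n
      · simp only [if_true, add_zero]
        split_ifs <;> first | contradiction | omega | simp [tE_sq]
      · simp only [Nat.add_eq_zero_iff, one_ne_zero, and_false, if_false, Nat.add_sub_cancel]
        split_ifs <;> first | omega | simp [tE_sq, tF_sq, tF_tE]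
    rw [this, Matrix.zero_mulVec]
end

section
/- (Katzman) Let K be a field and let R = K[a_0,a_1,a_2,a_3,a_4,b_0,b_1,b_2,b_3,b_4] be a polynomial ring in ten variables. Define the matrices over R: B_5 the 2 × 5 matrix with rows (a_0,a_1,a_2,a_3,a_4) and (b_0,b_1,b_2,b_3,b_4); B_4 the 4 × 4 matrix with rows (a_0,a_1,a_2,a_3), (a_1,a_2,a_3,a_4), (b_0,b_1,b_2,b_3), (b_1,b_2,b_3,b_4); and B_3 the 6 × 3 matrix with rows (a_0,a_1,a_2), (a_1,a_2,a_3), (a_2,a_3,a_4), (b_0,b_1,b_2), (b_1,b_2,b_3), (b_2,b_3,b_4). Then the ideal of R generated by all 3 × 3 minors of B_4 equals the intersection of the ideal generated by all 3 × 3 minors of B_3 with the ideal generated by all 2 × 2 minors of B_5: minors(3,B_4) = minors(3,B_3) ∩ minors(2,B_5). -/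
open MvPolynomial

universe u

/-- `minorsIdeal r M` is the ideal generated by the determinants of all `r × r` submatrices
of `M` (obtained by choosing `r` rows and `r` columns). -/
def minorsIdeal {R : Type u} [CommRing R] {p q : ℕ} (r : ℕ)
    (M : Matrix (Fin p) (Fin q) R) : Ideal R :=
  Ideal.span {d : R | ∃ (f : Fin r → Fin p) (g : Fin r → Fin q),
    StrictMono f ∧ StrictMono g ∧ d = (M.submatrix f g).det}

def VV {R : Type*} [CommRing R] {p q : ℕ} (r : ℕ) (M : Matrix (Fin p) (Fin q) R) : Prop :=
  ∀ (f : Fin r → Fin p) (g : Fin r → Fin q), StrictMono f → StrictMono g →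
    (M.submatrix f g).det = 0

section mats
variable {R : Type*} [CommRing R] (a0 a1 a2 a3 a4 b0 b1 b2 b3 b4 : R)

def M4 : Matrix (Fin 4) (Fin 4) R :=
  !![a0, a1, a2, a3; a1, a2, a3, a4; b0, b1, b2, b3; b1, b2, b3, b4]
def M3 : Matrix (Fin 6) (Fin 3) R :=
  !![a0, a1, a2; a1, a2, a3; a2, a3, a4; b0, b1, b2; b1, b2, b3; b2, b3, b4]
def M5 : Matrix (Fin 2) (Fin 5) R :=
  !![a0, a1, a2, a3, a4; b0, b1, b2, b3, b4]
def dd (x0 x1 x2 y0 y1 y2 z0 z1 z2 : R) : R :=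
  x0 * y1 * z2 - x0 * y2 * z1 - x1 * y0 * z2 + x1 * y2 * z0 + x2 * y0 * z1 - x2 * y1 * z0
def GG (i : ℕ) : R :=
  if i = 0 then dd a0 a1 a2 a1 a2 a3 a2 a3 a4
  else if i = 1 then dd b0 b1 b2 a1 a2 a3 a2 a3 a4
  else if i = 2 then dd b0 b1 b2 b1 b2 b3 a2 a3 a4
  else dd b0 b1 b2 b1 b2 b3 b2 b3 b4

lemma sm_3_4 (f : Fin 3 → Fin 4) (h : StrictMono f) :
    f = ![0, 1, 2] ∨ f = ![0, 1, 3] ∨ f = ![0, 2, 3] ∨ f = ![1, 2, 3] := by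
  have h0 : f 0 < f 1 := h (by decide)
  have h1 : f 1 < f 2 := h (by decide)
  have e : f = ![f 0, f 1, f 2] := by ext i; fin_cases i <;> rfl
  rw [e]
  generalize f 0 = x at *
  generalize f 1 = y at *
  generalize f 2 = z at *
  clear e h f
  revert x y z
  decide

lemma sm_3_6 (f : Fin 3 → Fin 6) (h : StrictMono f) :
    f = ![0, 1, 2] ∨ f = ![0, 1, 3] ∨ f = ![0, 1, 4] ∨ f = ![0, 1, 5] ∨ f = ![0, 2, 3] ∨ f = ![0, 2, 4] ∨ f = ![0, 2, 5] ∨ f = ![0, 3, 4] ∨ f = ![0, 3, 5] ∨ f = ![0, 4, 5] ∨ f = ![1, 2, 3] ∨ f = ![1, 2, 4] ∨ f = ![1, 2, 5] ∨ f = ![1, 3, 4] ∨ f = ![1, 3, 5] ∨ f = ![1, 4, 5] ∨ f = ![2, 3, 4] ∨ f = ![2, 3, 5] ∨ f = ![2, 4, 5] ∨ f = ![3, 4, 5] := by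
  have h0 : f 0 < f 1 := h (by decide)
  have h1 : f 1 < f 2 := h (by decide)
  have e : f = ![f 0, f 1, f 2] := by ext i; fin_cases i <;> rfl
  rw [e]
  generalize f 0 = x at *
  generalize f 1 = y at *
  generalize f 2 = z at *
  clear e h f
  revert x y z
  decide

lemma sm_3_3 (f : Fin 3 → Fin 3) (h : StrictMono f) :
    f = ![0, 1, 2] := by
  have h0 : f 0 < f 1 := h (by decide)
  have h1 : f 1 < f 2 := h (by decide)
  have e : f = ![f 0, f 1, f 2] := by ext i; fin_cases i <;> rfl
  rw [e]
  generalize f 0 = x at *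
  generalize f 1 = y at *
  generalize f 2 = z at *
  clear e h f
  revert x y z
  decide

lemma sm_2_2 (f : Fin 2 → Fin 2) (h : StrictMono f) :
    f = ![0, 1] := by
  have h0 : f 0 < f 1 := h (by decide)
  have e : f = ![f 0, f 1] := by ext i; fin_cases i <;> rfl
  rw [e]
  generalize f 0 = x at *
  generalize f 1 = y at *
  clear e h f
  revert x y
  decide

lemma sm_2_5 (f : Fin 2 → Fin 5) (h : StrictMono f) :
    f = ![0, 1] ∨ f = ![0, 2] ∨ f = ![0, 3] ∨ f = ![0, 4] ∨ f = ![1, 2] ∨ f = ![1, 3] ∨ f = ![1, 4] ∨ f = ![2, 3] ∨ f = ![2, 4] ∨ f = ![3, 4] := by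
  have h0 : f 0 < f 1 := h (by decide)
  have e : f = ![f 0, f 1] := by ext i; fin_cases i <;> rfl
  rw [e]
  generalize f 0 = x at *
  generalize f 1 = y at *
  clear e h f
  revert x y
  decide

set_option maxHeartbeats 4000000 in
lemma V4_of_V3 (H : VV 3 (M3 a0 a1 a2 a3 a4 b0 b1 b2 b3 b4)) :
    VV 3 (M4 a0 a1 a2 a3 a4 b0 b1 b2 b3 b4) := by
  have h012_012 := H ![0, 1, 2] ![0, 1, 2] (by decide) (by decide)
  have h013_012 := H ![0, 1, 3] ![0, 1, 2] (by decide) (by decide)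
  have h014_012 := H ![0, 1, 4] ![0, 1, 2] (by decide) (by decide)
  have h015_012 := H ![0, 1, 5] ![0, 1, 2] (by decide) (by decide)
  have h023_012 := H ![0, 2, 3] ![0, 1, 2] (by decide) (by decide)
  have h024_012 := H ![0, 2, 4] ![0, 1, 2] (by decide) (by decide)
  have h025_012 := H ![0, 2, 5] ![0, 1, 2] (by decide) (by decide)
  have h034_012 := H ![0, 3, 4] ![0, 1, 2] (by decide) (by decide)
  have h035_012 := H ![0, 3, 5] ![0, 1, 2] (by decide) (by decide)
  have h045_012 := H ![0, 4, 5] ![0, 1, 2] (by decide) (by decide)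
  have h123_012 := H ![1, 2, 3] ![0, 1, 2] (by decide) (by decide)
  have h124_012 := H ![1, 2, 4] ![0, 1, 2] (by decide) (by decide)
  have h125_012 := H ![1, 2, 5] ![0, 1, 2] (by decide) (by decide)
  have h134_012 := H ![1, 3, 4] ![0, 1, 2] (by decide) (by decide)
  have h135_012 := H ![1, 3, 5] ![0, 1, 2] (by decide) (by decide)
  have h145_012 := H ![1, 4, 5] ![0, 1, 2] (by decide) (by decide)
  have h234_012 := H ![2, 3, 4] ![0, 1, 2] (by decide) (by decide)
  have h235_012 := H ![2, 3, 5] ![0, 1, 2] (by decide) (by decide)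
  have h245_012 := H ![2, 4, 5] ![0, 1, 2] (by decide) (by decide)
  have h345_012 := H ![3, 4, 5] ![0, 1, 2] (by decide) (by decide)
  simp only [Matrix.det_fin_three, Matrix.submatrix_apply] at h012_012 h013_012 h014_012 h015_012 h023_012 h024_012 h025_012 h034_012 h035_012 h045_012 h123_012 h124_012 h125_012 h134_012 h135_012 h145_012 h234_012 h235_012 h245_012 h345_012
  simp [M3] at h012_012 h013_012 h014_012 h015_012 h023_012 h024_012 h025_012 h034_012 h035_012 h045_012 h123_012 h124_012 h125_012 h134_012 h135_012 h145_012 h234_012 h235_012 h245_012 h345_012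
  intro f g hf hg
  rcases sm_3_4 f hf with rfl | rfl | rfl | rfl <;>
    rcases sm_3_4 g hg with rfl | rfl | rfl | rfl <;>
    simp only [Matrix.det_fin_three, Matrix.submatrix_apply] <;> simp [M4]
  · linear_combination h013_012
  · linear_combination h014_012 + h023_012
  · linear_combination h024_012 + h123_012
  · linear_combination h124_012
  · linear_combination h014_012
  · linear_combination h015_012 + h024_012
  · linear_combination h025_012 + h124_012
  · linear_combination h125_012
  · linear_combination h034_012
  · linear_combination h035_012 + h134_012
  · linear_combination h045_012 + h135_012
  · linear_combination h145_012
  · linear_combination h134_012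
  · linear_combination h135_012 + h234_012
  · linear_combination h145_012 + h235_012
  · linear_combination h245_012

set_option maxHeartbeats 4000000 in
lemma V4_of_V5 (H : VV 2 (M5 a0 a1 a2 a3 a4 b0 b1 b2 b3 b4)) :
    VV 3 (M4 a0 a1 a2 a3 a4 b0 b1 b2 b3 b4) := by
  have h01_01 := H ![0, 1] ![0, 1] (by decide) (by decide)
  have h01_02 := H ![0, 1] ![0, 2] (by decide) (by decide)
  have h01_03 := H ![0, 1] ![0, 3] (by decide) (by decide)
  have h01_04 := H ![0, 1] ![0, 4] (by decide) (by decide)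
  have h01_12 := H ![0, 1] ![1, 2] (by decide) (by decide)
  have h01_13 := H ![0, 1] ![1, 3] (by decide) (by decide)
  have h01_14 := H ![0, 1] ![1, 4] (by decide) (by decide)
  have h01_23 := H ![0, 1] ![2, 3] (by decide) (by decide)
  have h01_24 := H ![0, 1] ![2, 4] (by decide) (by decide)
  have h01_34 := H ![0, 1] ![3, 4] (by decide) (by decide)
  simp only [Matrix.det_fin_two, Matrix.submatrix_apply] at h01_01 h01_02 h01_03 h01_04 h01_12 h01_13 h01_14 h01_23 h01_24 h01_34
  simp [M5] at h01_01 h01_02 h01_03 h01_04 h01_12 h01_13 h01_14 h01_23 h01_24 h01_34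
  intro f g hf hg
  rcases sm_3_4 f hf with rfl | rfl | rfl | rfl <;>
    rcases sm_3_4 g hg with rfl | rfl | rfl | rfl <;>
    simp only [Matrix.det_fin_three, Matrix.submatrix_apply] <;> simp [M4]
  · linear_combination a0 * h01_13 - a1 * h01_03 - a1 * h01_12 + a2 * h01_02
  · linear_combination a0 * h01_14 - a1 * h01_04 - a1 * h01_13 + a2 * h01_03
  · linear_combination a0 * h01_24 - a1 * h01_23 - a2 * h01_04 + a3 * h01_03
  · linear_combination a1 * h01_24 - a2 * h01_14 - a2 * h01_23 + a3 * h01_13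
  · linear_combination a0 * h01_23 - a1 * h01_13 + a2 * h01_12
  · linear_combination a0 * h01_24 - a1 * h01_14 - a1 * h01_23 + a2 * h01_13
  · linear_combination a0 * h01_34 - a2 * h01_14 + a3 * h01_13
  · linear_combination a1 * h01_34 - a2 * h01_24 + a3 * h01_23
  · linear_combination - b0 * h01_13 + b1 * h01_03 + b1 * h01_12 - b2 * h01_02
  · linear_combination - b0 * h01_14 + b1 * h01_04 + b1 * h01_13 - b2 * h01_03
  · linear_combination - b0 * h01_24 + b1 * h01_23 + b2 * h01_04 - b3 * h01_03
  · linear_combination - b1 * h01_24 + b2 * h01_14 + b2 * h01_23 - b3 * h01_13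
  · linear_combination - b0 * h01_23 + b1 * h01_13 - b2 * h01_12
  · linear_combination - b0 * h01_24 + b1 * h01_14 + b1 * h01_23 - b2 * h01_13
  · linear_combination - b0 * h01_34 + b2 * h01_14 - b3 * h01_13
  · linear_combination - b1 * h01_34 + b2 * h01_24 - b3 * h01_23

set_option maxHeartbeats 4000000 in
lemma V3_of_V4 (H : VV 3 (M4 a0 a1 a2 a3 a4 b0 b1 b2 b3 b4))
    (hG : ∀ i < 4, GG a0 a1 a2 a3 a4 b0 b1 b2 b3 b4 i = 0) :
    VV 3 (M3 a0 a1 a2 a3 a4 b0 b1 b2 b3 b4) := by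
  have h012_012 := H ![0, 1, 2] ![0, 1, 2] (by decide) (by decide)
  have h012_013 := H ![0, 1, 2] ![0, 1, 3] (by decide) (by decide)
  have h012_023 := H ![0, 1, 2] ![0, 2, 3] (by decide) (by decide)
  have h012_123 := H ![0, 1, 2] ![1, 2, 3] (by decide) (by decide)
  have h013_012 := H ![0, 1, 3] ![0, 1, 2] (by decide) (by decide)
  have h013_013 := H ![0, 1, 3] ![0, 1, 3] (by decide) (by decide)
  have h013_023 := H ![0, 1, 3] ![0, 2, 3] (by decide) (by decide)
  have h013_123 := H ![0, 1, 3] ![1, 2, 3] (by decide) (by decide)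
  have h023_012 := H ![0, 2, 3] ![0, 1, 2] (by decide) (by decide)
  have h023_013 := H ![0, 2, 3] ![0, 1, 3] (by decide) (by decide)
  have h023_023 := H ![0, 2, 3] ![0, 2, 3] (by decide) (by decide)
  have h023_123 := H ![0, 2, 3] ![1, 2, 3] (by decide) (by decide)
  have h123_012 := H ![1, 2, 3] ![0, 1, 2] (by decide) (by decide)
  have h123_013 := H ![1, 2, 3] ![0, 1, 3] (by decide) (by decide)
  have h123_023 := H ![1, 2, 3] ![0, 2, 3] (by decide) (by decide)
  have h123_123 := H ![1, 2, 3] ![1, 2, 3] (by decide) (by decide)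
  simp only [Matrix.det_fin_three, Matrix.submatrix_apply] at h012_012 h012_013 h012_023 h012_123 h013_012 h013_013 h013_023 h013_123 h023_012 h023_013 h023_023 h023_123 h123_012 h123_013 h123_023 h123_123
  simp [M4] at h012_012 h012_013 h012_023 h012_123 h013_012 h013_013 h013_023 h013_123 h023_012 h023_013 h023_023 h023_123 h123_012 h123_013 h123_023 h123_123
  have g0 := hG 0 (by decide)
  have g1 := hG 1 (by decide)
  have g2 := hG 2 (by decide)
  have g3 := hG 3 (by decide)
  simp [GG, dd] at g0 g1 g2 g3
  intro f g hf hg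
  rcases sm_3_6 f hf with rfl | rfl | rfl | rfl | rfl | rfl | rfl | rfl | rfl | rfl | rfl | rfl | rfl | rfl | rfl | rfl | rfl | rfl | rfl | rfl <;>
    rcases sm_3_3 g hg with rfl <;>
    simp only [Matrix.det_fin_three, Matrix.submatrix_apply] <;> simp [M3]
  · linear_combination g0
  · linear_combination h012_012
  · linear_combination h013_012
  · linear_combination - h012_023 + h013_013 + g1
  · linear_combination h012_013 - h013_012
  · linear_combination h012_023 - g1
  · linear_combination - h012_123 + h013_023
  · linear_combination h023_012
  · linear_combination h023_013 - h123_012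
  · linear_combination h023_023 - h123_013 + g2
  · linear_combination g1
  · linear_combination h012_123
  · linear_combination h013_123
  · linear_combination h123_012
  · linear_combination h123_013 - g2
  · linear_combination h023_123
  · linear_combination g2
  · linear_combination - h023_123 + h123_023
  · linear_combination h123_123
  · linear_combination g3

set_option maxHeartbeats 4000000 in
lemma syz_of_V4 (H : VV 3 (M4 a0 a1 a2 a3 a4 b0 b1 b2 b3 b4)) (i : ℕ) (hi : i < 3) (j : Fin 5) :
    ![b0, b1, b2, b3, b4] j * GG a0 a1 a2 a3 a4 b0 b1 b2 b3 b4 i =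
    ![a0, a1, a2, a3, a4] j * GG a0 a1 a2 a3 a4 b0 b1 b2 b3 b4 (i + 1) := by
  have h012_012 := H ![0, 1, 2] ![0, 1, 2] (by decide) (by decide)
  have h012_013 := H ![0, 1, 2] ![0, 1, 3] (by decide) (by decide)
  have h012_023 := H ![0, 1, 2] ![0, 2, 3] (by decide) (by decide)
  have h012_123 := H ![0, 1, 2] ![1, 2, 3] (by decide) (by decide)
  have h013_012 := H ![0, 1, 3] ![0, 1, 2] (by decide) (by decide)
  have h013_013 := H ![0, 1, 3] ![0, 1, 3] (by decide) (by decide)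
  have h013_023 := H ![0, 1, 3] ![0, 2, 3] (by decide) (by decide)
  have h013_123 := H ![0, 1, 3] ![1, 2, 3] (by decide) (by decide)
  have h023_012 := H ![0, 2, 3] ![0, 1, 2] (by decide) (by decide)
  have h023_013 := H ![0, 2, 3] ![0, 1, 3] (by decide) (by decide)
  have h023_023 := H ![0, 2, 3] ![0, 2, 3] (by decide) (by decide)
  have h023_123 := H ![0, 2, 3] ![1, 2, 3] (by decide) (by decide)
  have h123_012 := H ![1, 2, 3] ![0, 1, 2] (by decide) (by decide)
  have h123_013 := H ![1, 2, 3] ![0, 1, 3] (by decide) (by decide)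
  have h123_023 := H ![1, 2, 3] ![0, 2, 3] (by decide) (by decide)
  have h123_123 := H ![1, 2, 3] ![1, 2, 3] (by decide) (by decide)
  simp only [Matrix.det_fin_three, Matrix.submatrix_apply] at h012_012 h012_013 h012_023 h012_123 h013_012 h013_013 h013_023 h013_123 h023_012 h023_013 h023_023 h023_123 h123_012 h123_013 h123_023 h123_123
  simp [M4] at h012_012 h012_013 h012_023 h012_123 h013_012 h013_013 h013_023 h013_123 h023_012 h023_013 h023_023 h023_123 h123_012 h123_013 h123_023 h123_123
  interval_cases i <;> fin_cases j <;> simp [GG, dd]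
  · linear_combination - a1 * h012_013 + a1 * h013_012 + a2 * h012_012
  · linear_combination a0 * h012_123 - a1 * h012_023 + a2 * h013_012
  · linear_combination a0 * h013_123 + a1 * h012_123 - a1 * h013_023 - a2 * h012_023 + a2 * h013_013
  · linear_combination a1 * h013_123 + a2 * h012_123 - a2 * h013_023 - a3 * h012_023 + a3 * h013_013
  · linear_combination a2 * h013_123 + a3 * h012_123 - a3 * h013_023 - a4 * h012_023 + a4 * h013_013
  · linear_combination - a0 * h123_013 + a1 * h023_013 - a2 * h023_012 + b0 * h012_023 - b0 * h013_013 + b1 * h013_012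
  · linear_combination - a2 * h123_012 + b0 * h012_123
  · linear_combination - a1 * h023_123 + a1 * h123_023 - a2 * h123_013 + b0 * h013_123
  · linear_combination - a2 * h023_123 + a2 * h123_023 - a3 * h123_013 + b1 * h013_123
  · linear_combination - a3 * h023_123 + a3 * h123_023 - a4 * h123_013 + b2 * h013_123
  · linear_combination - b0 * h023_023 + b0 * h123_013 + b1 * h023_013 - b1 * h123_012 - b2 * h023_012
  · linear_combination - b0 * h023_123 + b1 * h123_013 - b2 * h123_012
  · linear_combination - b0 * h123_123 - b1 * h023_123 + b1 * h123_023
  · linear_combination - b1 * h123_123 - b2 * h023_123 + b2 * h123_023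
  · linear_combination - b2 * h123_123 - b3 * h023_123 + b3 * h123_023

end mats

section key
variable {Q : Type*} [CommRing Q]

def PP (a b : Fin 5 → Q) (β γ : Fin 5 → ℕ) : Q := (∏ j, a j ^ β j) * ∏ j, b j ^ γ j

lemma prod_single (a : Fin 5 → Q) (β : Fin 5 → ℕ) (j : Fin 5) :
    ∏ k, a k ^ (β + Pi.single j 1 : Fin 5 → ℕ) k = a j * ∏ k, a k ^ β k := by
  have : ∏ k, a k ^ (Pi.single j 1 : Fin 5 → ℕ) k = a j := by
    rw [Finset.prod_eq_single j]
    · simp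
    · intro k _ hk; simp [Pi.single_eq_of_ne hk]
    · simp
  simp only [Pi.add_apply, pow_add, Finset.prod_mul_distrib, this]
  ring

lemma PP_left (a b : Fin 5 → Q) (β γ : Fin 5 → ℕ) (j : Fin 5) :
    PP a b (β + Pi.single j 1) γ = a j * PP a b β γ := by
  unfold PP; rw [prod_single]; ring

lemma PP_right (a b : Fin 5 → Q) (β γ : Fin 5 → ℕ) (j : Fin 5) :
    PP a b β (γ + Pi.single j 1) = b j * PP a b β γ := by
  unfold PP; rw [prod_single]; ring

lemma sum_single (β : Fin 5 → ℕ) (j : Fin 5) :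
    ∑ k, (β + Pi.single j 1 : Fin 5 → ℕ) k = ∑ k, β k + 1 := by
  simp [Finset.sum_add_distrib]

lemma exists_sub (β : Fin 5 → ℕ) (j : Fin 5) (h : 0 < β j) :
    ∃ β0 : Fin 5 → ℕ, β = β0 + Pi.single j 1 := by
  refine ⟨β - Pi.single j 1, ?_⟩
  ext k
  by_cases hk : k = j
  · subst hk; simp; omega
  · simp [Pi.single_eq_of_ne hk]

lemma key_eq (a b : Fin 5 → Q) (g : ℕ → Q)
    (hg : ∀ i < 3, ∀ j, b j * g i = a j * g (i + 1)) (n : ℕ) :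
    ∀ (β γ β' γ' : Fin 5 → ℕ) (i i' : ℕ), i ≤ 3 → i' ≤ 3 → ∑ k, (β + γ) k = n →
      β + γ = β' + γ' → ∑ k, γ k + i = ∑ k, γ' k + i' →
      PP a b β γ * g i = PP a b β' γ' * g i' := by
  have up : ∀ (β γ : Fin 5 → ℕ) (j : Fin 5) (i : ℕ), i < 3 →
      PP a b β (γ + Pi.single j 1) * g i = PP a b (β + Pi.single j 1) γ * g (i + 1) := by
    intro β γ j i hi
    rw [PP_left, PP_right]
    linear_combination PP a b β γ * hg i hi j
  induction n with
  | zero =>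
    intro β γ β' γ' i i' hi hi' h0 h1 h2
    have h3 := h0
    rw [h1] at h3
    simp only [Finset.sum_eq_zero_iff, Finset.mem_univ, true_imp_iff, Pi.add_apply,
      Nat.add_eq_zero_iff] at h0 h3
    have e1 : β = 0 := funext fun k => (h0 k).1
    have e2 : γ = 0 := funext fun k => (h0 k).2
    have e3 : β' = 0 := funext fun k => (h3 k).1
    have e4 : γ' = 0 := funext fun k => (h3 k).2
    subst e1 e2 e3 e4
    simp at h2
    rw [h2]
  | succ n ih =>
    have hA : ∀ (β γ β' γ' : Fin 5 → ℕ) (i i' : ℕ) (j : Fin 5), i ≤ 3 → i' ≤ 3 →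
        ∑ k, (β + Pi.single j 1 + γ : Fin 5 → ℕ) k = n + 1 →
        β + Pi.single j 1 + γ = β' + Pi.single j 1 + γ' → ∑ k, γ k + i = ∑ k, γ' k + i' →
        PP a b (β + Pi.single j 1) γ * g i = PP a b (β' + Pi.single j 1) γ' * g i' := by
      intro β γ β' γ' i i' j hi hi' h0 h1 h2
      rw [add_right_comm, sum_single] at h0
      rw [add_right_comm, add_right_comm β'] at h1
      rw [PP_left, PP_left, mul_assoc, mul_assoc,
        ih β γ β' γ' i i' hi hi' (by omega) (add_right_cancel h1) h2]
    have hB : ∀ (β γ β' γ' : Fin 5 → ℕ) (i i' : ℕ) (j : Fin 5), i ≤ 3 → i' ≤ 3 →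
        ∑ k, (β + (γ + Pi.single j 1) : Fin 5 → ℕ) k = n + 1 →
        β + (γ + Pi.single j 1) = β' + (γ' + Pi.single j 1) →
        ∑ k, γ k + i = ∑ k, γ' k + i' →
        PP a b β (γ + Pi.single j 1) * g i = PP a b β' (γ' + Pi.single j 1) * g i' := by
      intro β γ β' γ' i i' j hi hi' h0 h1 h2
      rw [← add_assoc, sum_single] at h0
      rw [← add_assoc, ← add_assoc] at h1
      rw [PP_right, PP_right, mul_assoc, mul_assoc,
        ih β γ β' γ' i i' hi hi' (by omega) (add_right_cancel h1) h2]
    have hC : ∀ (β γ β' γ' : Fin 5 → ℕ) (i i' : ℕ) (j : Fin 5), i ≤ 3 → i' ≤ 3 →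
        ∑ k, (β + Pi.single j 1 + γ : Fin 5 → ℕ) k = n + 1 →
        β + Pi.single j 1 + γ = β' + (γ' + Pi.single j 1) →
        ∑ k, γ k + i = ∑ k, (γ' + Pi.single j 1 : Fin 5 → ℕ) k + i' →
        PP a b (β + Pi.single j 1) γ * g i = PP a b β' (γ' + Pi.single j 1) * g i' := by
      intro β γ β' γ' i i' j hi hi' h0 h1 h2
      rw [sum_single] at h2
      by_cases c : i' < 3
      · rw [up β' γ' j i' c]
        refine hA _ _ _ _ _ _ _ hi (by omega) h0 (by rw [h1]; abel) (by omega)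
      · have c3 : i' = 3 := by omega
        subst c3
        rcases Nat.eq_zero_or_pos i with c0 | c0
        · subst c0
          have : ∃ k, 0 < γ k := by
            by_contra! hk
            have : ∑ k, γ k = 0 := Finset.sum_eq_zero fun k _ => by have := hk k; omega
            omega
          obtain ⟨k, hk⟩ := this
          obtain ⟨γ, rfl⟩ := exists_sub γ k hk
          rw [sum_single] at h2
          rw [up _ γ k 0 (by decide), add_right_comm, ← up _ γ j 0 (by decide)]
          have e : β + Pi.single k 1 + (γ + Pi.single j 1)
            = β + Pi.single j 1 + (γ + Pi.single k 1) := by abel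
          exact hB _ _ _ _ _ _ _ hi (by omega) (by rw [e, h0]) (by rw [e, h1]) (by omega)
        · obtain ⟨i, rfl⟩ : ∃ i0, i = i0 + 1 := ⟨i - 1, by omega⟩
          rw [← up β γ j i (by omega)]
          have e : β + (γ + Pi.single j 1) = β + Pi.single j 1 + γ := by abel
          exact hB _ _ _ _ _ _ _ (by omega) (by omega) (by rw [e, h0]) (by rw [e, h1]) (by omega)
    intro β γ β' γ' i i' hi hi' h0 h1 h2
    have : ∃ k, 0 < (β + γ) k := by
      by_contra! hk
      have : ∑ k, (β + γ) k = 0 := Finset.sum_eq_zero fun k _ => by have := hk k; omega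
      omega
    obtain ⟨j, hj⟩ := this
    have hj' := hj
    rw [h1] at hj'
    simp only [Pi.add_apply] at hj hj'
    have h0' := h0
    rw [h1] at h0'
    rcases Nat.eq_zero_or_pos (β j) with c | c <;> rcases Nat.eq_zero_or_pos (β' j) with c' | c'
    · obtain ⟨γ, rfl⟩ := exists_sub γ j (by omega)
      obtain ⟨γ', rfl⟩ := exists_sub γ' j (by omega)
      rw [sum_single, sum_single] at h2
      exact hB _ _ _ _ _ _ _ hi hi' h0 h1 (by omega)
    · obtain ⟨γ, rfl⟩ := exists_sub γ j (by omega)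
      obtain ⟨β', rfl⟩ := exists_sub β' j (by omega)
      exact (hC _ _ _ _ _ _ _ hi' hi h0' h1.symm h2.symm).symm
    · obtain ⟨β, rfl⟩ := exists_sub β j (by omega)
      obtain ⟨γ', rfl⟩ := exists_sub γ' j (by omega)
      exact hC _ _ _ _ _ _ _ hi hi' h0 h1 h2
    · obtain ⟨β, rfl⟩ := exists_sub β j (by omega)
      obtain ⟨β', rfl⟩ := exists_sub β' j (by omega)
      exact hA _ _ _ _ _ _ _ hi hi' h0 h1 h2

end key

lemma minors_le_ker {R S : Type u} [CommRing R] [CommRing S] {p q : ℕ} (r : ℕ)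
    (M : Matrix (Fin p) (Fin q) R) (φ : R →+* S) :
    minorsIdeal r M ≤ RingHom.ker φ ↔ VV r (M.map φ) := by
  unfold minorsIdeal VV
  rw [Ideal.span_le]
  have e : ∀ (f : Fin r → Fin p) (g : Fin r → Fin q),
      ((M.map φ).submatrix f g).det = φ (M.submatrix f g).det := by
    intro f g
    rw [RingHom.map_det]; rfl
  constructor
  · intro h f g hf hg
    rw [e]
    exact h ⟨f, g, hf, hg, rfl⟩
  · rintro h d ⟨f, g, hf, hg, rfl⟩
    rw [SetLike.mem_coe, RingHom.mem_ker, ← e]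
    exact h f g hf hg

section maps
variable {R S : Type*} [CommRing R] [CommRing S] (φ : R →+* S)
  (a0 a1 a2 a3 a4 b0 b1 b2 b3 b4 : R)

lemma M4_map : (M4 a0 a1 a2 a3 a4 b0 b1 b2 b3 b4).map φ =
    M4 (φ a0) (φ a1) (φ a2) (φ a3) (φ a4) (φ b0) (φ b1) (φ b2) (φ b3) (φ b4) := by
  ext i j; fin_cases i <;> fin_cases j <;> rfl

lemma M3_map : (M3 a0 a1 a2 a3 a4 b0 b1 b2 b3 b4).map φ =
    M3 (φ a0) (φ a1) (φ a2) (φ a3) (φ a4) (φ b0) (φ b1) (φ b2) (φ b3) (φ b4) := by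
  ext i j; fin_cases i <;> fin_cases j <;> rfl

lemma M5_map : (M5 a0 a1 a2 a3 a4 b0 b1 b2 b3 b4).map φ =
    M5 (φ a0) (φ a1) (φ a2) (φ a3) (φ a4) (φ b0) (φ b1) (φ b2) (φ b3) (φ b4) := by
  ext i j; fin_cases i <;> fin_cases j <;> rfl

lemma GG_map (i : ℕ) : φ (GG a0 a1 a2 a3 a4 b0 b1 b2 b3 b4 i) =
    GG (φ a0) (φ a1) (φ a2) (φ a3) (φ a4) (φ b0) (φ b1) (φ b2) (φ b3) (φ b4) i := by
  unfold GG dd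
  split_ifs <;> simp

end maps

section final
variable (K : Type u) [Field K]

abbrev TT := MvPolynomial (Fin 2 ⊕ Fin 5) K

noncomputable def phi : MvPolynomial (Fin 10) K →ₐ[K] TT K :=
  aeval (Fin.addCases (m := 5) (n := 5) (fun j => X (Sum.inl 0) * X (Sum.inr j))
    (fun j => X (Sum.inl 1) * X (Sum.inr j)))

noncomputable def keyE (T : Fin 4 × (Fin 10 →₀ ℕ)) : (Fin 2 ⊕ Fin 5) →₀ ℕ :=
  Finsupp.equivFunOnFinite.symm (Sum.elim
    ![∑ j : Fin 5, T.2 (Fin.castAdd 5 j) + (3 - T.1.val),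
      ∑ j : Fin 5, T.2 (Fin.natAdd 5 j) + T.1.val]
    (fun j => T.2 (Fin.castAdd 5 j) + T.2 (Fin.natAdd 5 j)))

lemma monomial_prod (m : Fin 10 →₀ ℕ) : (monomial m (1 : K)) =
    (∏ j : Fin 5, X (Fin.castAdd 5 j) ^ m (Fin.castAdd 5 j)) *
      ∏ j : Fin 5, X (Fin.natAdd 5 j) ^ m (Fin.natAdd 5 j) := by
  rw [monomial_eq, Finsupp.prod_fintype _ _ (by simp), C_1, one_mul]
  exact Fin.prod_univ_add (a := 5) (b := 5) _

lemma phi_monomial (i : Fin 4) (m : Fin 10 →₀ ℕ) :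
    phi K (monomial m 1) * (X (Sum.inl 0) ^ (3 - i.val) * X (Sum.inl 1) ^ i.val) =
      monomial (keyE (i, m)) 1 := by
  have h1 : ∀ j : Fin 5, phi K (X (Fin.castAdd 5 j)) = X (Sum.inl 0) * X (Sum.inr j) := by
    intro j
    unfold phi
    erw [aeval_X]
    exact Fin.addCases_left j
  have h2 : ∀ j : Fin 5, phi K (X (Fin.natAdd 5 j)) = X (Sum.inl 1) * X (Sum.inr j) := by
    intro j
    unfold phi
    erw [aeval_X]
    exact Fin.addCases_right j
  rw [monomial_prod, map_mul, map_prod, map_prod]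
  simp only [map_pow, h1, h2]
  rw [monomial_eq, Finsupp.prod_fintype _ _ (by simp), C_1, one_mul, Fintype.prod_sum_type,
    Fin.prod_univ_two]
  simp only [keyE, Finsupp.equivFunOnFinite_symm_apply_apply, Sum.elim_inl, Sum.elim_inr,
    Matrix.cons_val_zero, Matrix.cons_val_one, pow_add, mul_pow, Finset.prod_mul_distrib,
    Finset.prod_pow_eq_pow_sum]
  ring

lemma syz_lemma (Q : Type u) [CommRing Q] [Algebra K Q] (π : MvPolynomial (Fin 10) K →ₐ[K] Q)
    (g : ℕ → Q)
    (hg : ∀ i < 3, ∀ j : Fin 5, π (X (Fin.natAdd 5 j)) * g i = π (X (Fin.castAdd 5 j)) * g (i + 1))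
    (c : Fin 4 → MvPolynomial (Fin 10) K)
    (hc : ∑ i : Fin 4, phi K (c i) * (X (Sum.inl 0) ^ (3 - i.val) * X (Sum.inl 1) ^ i.val) = 0) :
    ∑ i : Fin 4, π (c i) * g i.val = 0 := by
  let v : Fin 4 × (Fin 10 →₀ ℕ) → Q := fun T => π (monomial T.2 1) * g T.1.val
  have hv : Function.FactorsThrough v keyE := by
    rintro ⟨i, m⟩ ⟨i', m'⟩ h
    have e1 := DFunLike.congr_fun h (Sum.inl 1)
    have e2 := fun j => DFunLike.congr_fun h (Sum.inr j)
    simp only [keyE, Finsupp.equivFunOnFinite_symm_apply_apply, Sum.elim_inl, Sum.elim_inr,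
      Matrix.cons_val_one] at e1 e2
    have := key_eq (fun j => π (X (Fin.castAdd 5 j))) (fun j => π (X (Fin.natAdd 5 j))) g hg _
      (fun j => m (Fin.castAdd 5 j)) (fun j => m (Fin.natAdd 5 j))
      (fun j => m' (Fin.castAdd 5 j)) (fun j => m' (Fin.natAdd 5 j)) i.val i'.val
      (by omega) (by omega) rfl (funext e2) (by simpa using e1)
    simp only [v]
    rw [monomial_prod, monomial_prod, map_mul, map_mul, map_prod, map_prod, map_prod, map_prod]
    simp only [map_pow]
    exact this
  let σ : TT K →ₗ[K] Q := (basisMonomials (Fin 2 ⊕ Fin 5) K).constr K (Function.extend keyE v 0)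
  have hσ : ∀ T, σ (monomial (keyE T) 1) = v T := by
    intro T
    have := (basisMonomials (Fin 2 ⊕ Fin 5) K).constr_basis K (Function.extend keyE v 0) (keyE T)
    rw [coe_basisMonomials] at this
    exact this.trans (hv.extend_apply _ _)
  have key : ∀ (i : Fin 4) (p : MvPolynomial (Fin 10) K),
      σ (phi K p * (X (Sum.inl 0) ^ (3 - i.val) * X (Sum.inl 1) ^ i.val)) = π p * g i.val := by
    intro i p
    induction p using MvPolynomial.induction_on' with
    | monomial m r =>
      have : (monomial m r : MvPolynomial (Fin 10) K) = r • monomial m 1 := by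
        rw [smul_monomial, smul_eq_mul, mul_one]
      rw [this, map_smul, map_smul, smul_mul_assoc, smul_mul_assoc, map_smul, phi_monomial, hσ]
    | add p q hp hq => rw [map_add, map_add, add_mul, add_mul, map_add, hp, hq]
  simp only [← key]
  rw [← map_sum, hc, map_zero]

lemma phi_val : phi K (X 0) = X (Sum.inl 0) * X (Sum.inr 0) ∧
    phi K (X 1) = X (Sum.inl 0) * X (Sum.inr 1) ∧
    phi K (X 2) = X (Sum.inl 0) * X (Sum.inr 2) ∧
    phi K (X 3) = X (Sum.inl 0) * X (Sum.inr 3) ∧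
    phi K (X 4) = X (Sum.inl 0) * X (Sum.inr 4) ∧
    phi K (X 5) = X (Sum.inl 1) * X (Sum.inr 0) ∧
    phi K (X 6) = X (Sum.inl 1) * X (Sum.inr 1) ∧
    phi K (X 7) = X (Sum.inl 1) * X (Sum.inr 2) ∧
    phi K (X 8) = X (Sum.inl 1) * X (Sum.inr 3) ∧
    phi K (X 9) = X (Sum.inl 1) * X (Sum.inr 4) := by
  unfold phi
  refine ⟨?_, ?_, ?_, ?_, ?_, ?_, ?_, ?_, ?_, ?_⟩ <;> erw [aeval_X] <;> rfl

lemma V5_rank_one {S : Type*} [CommRing S] (s t u0 u1 u2 u3 u4 : S) :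
    VV 2 (M5 (s * u0) (s * u1) (s * u2) (s * u3) (s * u4)
      (t * u0) (t * u1) (t * u2) (t * u3) (t * u4)) := by
  intro f g hf hg
  rcases sm_2_2 f hf with rfl
  rcases sm_2_5 g hg with rfl | rfl | rfl | rfl | rfl | rfl | rfl | rfl | rfl | rfl <;>
    simp only [Matrix.det_fin_two, Matrix.submatrix_apply] <;> simp [M5] <;> ring

lemma GG_rank_one {S : Type*} [CommRing S] (s t u0 u1 u2 u3 u4 : S) (i : Fin 4) :
    GG (s * u0) (s * u1) (s * u2) (s * u3) (s * u4)
      (t * u0) (t * u1) (t * u2) (t * u3) (t * u4) i.val =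
    (s ^ (3 - i.val) * t ^ i.val) * dd u0 u1 u2 u1 u2 u3 u2 u3 u4 := by
  fin_cases i <;> simp [GG, dd] <;> ring

lemma hank_ne : dd (X (Sum.inr 0) : TT K) (X (Sum.inr 1)) (X (Sum.inr 2)) (X (Sum.inr 1))
    (X (Sum.inr 2)) (X (Sum.inr 3)) (X (Sum.inr 2)) (X (Sum.inr 3)) (X (Sum.inr 4)) ≠ 0 := by
  intro h
  have := congrArg (eval (Sum.elim (fun _ => (0 : K)) ![0, 0, 1, 0, 0])) h
  simp [dd] at this

end final

/-- **Katzman.**  In `R = K[a₀,…,a₄,b₀,…,b₄]` (here `aᵢ = X i`,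
`bᵢ = X (i+5)`), with `B₅`, `B₄`, `B₃` the stacked Hankel matrices of the statement,
the ideal of `3 × 3` minors of `B₄` equals the intersection of the ideal of `3 × 3` minors
of `B₃` with the ideal of `2 × 2` minors of `B₅`. -/
theorem katzman_minors_intersection (K : Type u) [Field K] :
    minorsIdeal 3
        (!![X 0, X 1, X 2, X 3;
            X 1, X 2, X 3, X 4;
            X 5, X 6, X 7, X 8;
            X 6, X 7, X 8, X 9] :
          Matrix (Fin 4) (Fin 4) (MvPolynomial (Fin 10) K)) =
      minorsIdeal 3
          (!![X 0, X 1, X 2;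
              X 1, X 2, X 3;
              X 2, X 3, X 4;
              X 5, X 6, X 7;
              X 6, X 7, X 8;
              X 7, X 8, X 9] :
            Matrix (Fin 6) (Fin 3) (MvPolynomial (Fin 10) K)) ⊓
        minorsIdeal 2
          (!![X 0, X 1, X 2, X 3, X 4;
              X 5, X 6, X 7, X 8, X 9] :
            Matrix (Fin 2) (Fin 5) (MvPolynomial (Fin 10) K)) := by
  let A : Fin 10 → MvPolynomial (Fin 10) K := X
  let N4 := M4 (A 0) (A 1) (A 2) (A 3) (A 4) (A 5) (A 6) (A 7) (A 8) (A 9)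
  let N3 := M3 (A 0) (A 1) (A 2) (A 3) (A 4) (A 5) (A 6) (A 7) (A 8) (A 9)
  let N5 := M5 (A 0) (A 1) (A 2) (A 3) (A 4) (A 5) (A 6) (A 7) (A 8) (A 9)
  let G : ℕ → MvPolynomial (Fin 10) K :=
    GG (A 0) (A 1) (A 2) (A 3) (A 4) (A 5) (A 6) (A 7) (A 8) (A 9)
  change minorsIdeal 3 N4 = minorsIdeal 3 N3 ⊓ minorsIdeal 2 N5
  have h43 : minorsIdeal 3 N4 ≤ minorsIdeal 3 N3 := by
    have h := (minors_le_ker 3 N3 (Ideal.Quotient.mk (minorsIdeal 3 N3))).1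
      (by rw [Ideal.mk_ker])
    rw [M3_map] at h
    have h' := V4_of_V3 _ _ _ _ _ _ _ _ _ _ h
    rw [← M4_map] at h'
    have := (minors_le_ker 3 N4 _).2 h'
    rwa [Ideal.mk_ker] at this
  have h45 : minorsIdeal 3 N4 ≤ minorsIdeal 2 N5 := by
    have h := (minors_le_ker 2 N5 (Ideal.Quotient.mk (minorsIdeal 2 N5))).1
      (by rw [Ideal.mk_ker])
    rw [M5_map] at h
    have h' := V4_of_V5 _ _ _ _ _ _ _ _ _ _ h
    rw [← M4_map] at h'
    have := (minors_le_ker 3 N4 _).2 h'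
    rwa [Ideal.mk_ker] at this
  refine le_antisymm (le_inf h43 h45) ?_
  have h34 : minorsIdeal 3 N3 ≤
      minorsIdeal 3 N4 ⊔ Ideal.span (Set.range fun i : Fin 4 => G i.val) := by
    set J := minorsIdeal 3 N4 ⊔ Ideal.span (Set.range fun i : Fin 4 => G i.val) with hJ
    have h := (minors_le_ker 3 N4 (Ideal.Quotient.mk J)).1
      (by rw [Ideal.mk_ker]; exact le_sup_left)
    rw [M4_map] at h
    have h' := V3_of_V4 _ _ _ _ _ _ _ _ _ _ h (by
      intro i hi
      rw [← GG_map, Ideal.Quotient.eq_zero_iff_mem]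
      exact (le_sup_right : _ ≤ J) (Ideal.subset_span ⟨⟨i, hi⟩, rfl⟩))
    rw [← M3_map] at h'
    have := (minors_le_ker 3 N3 _).2 h'
    rwa [Ideal.mk_ker] at this
  obtain ⟨p0, p1, p2, p3, p4, p5, p6, p7, p8, p9⟩ := phi_val K
  have h5 : minorsIdeal 2 N5 ≤ RingHom.ker (phi K : MvPolynomial (Fin 10) K →+* TT K) := by
    rw [minors_le_ker, M5_map]
    simp only [A, RingHom.coe_coe, p0, p1, p2, p3, p4, p5, p6, p7, p8, p9]
    exact V5_rank_one _ _ _ _ _ _ _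
  rintro f ⟨hf3, hf5⟩
  obtain ⟨p, hp, q, hq, rfl⟩ := Submodule.mem_sup.1 (h34 hf3)
  obtain ⟨c, rfl⟩ := (Ideal.mem_span_range_iff_exists_fun).1 hq
  refine Ideal.add_mem _ hp ?_
  have e1 : phi K (p + ∑ i : Fin 4, c i * G i.val) = 0 := h5 hf5
  have e2 : phi K p = 0 := h5 (h45 hp)
  rw [map_add, e2, zero_add, map_sum] at e1
  have hG : ∀ i : Fin 4, phi K (G i.val) = _ := fun i =>
    (GG_map (phi K : MvPolynomial (Fin 10) K →+* TT K) _ _ _ _ _ _ _ _ _ _ i.val)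
  simp only [map_mul, hG] at e1
  simp only [A, RingHom.coe_coe, p0, p1, p2, p3, p4, p5, p6, p7, p8, p9, GG_rank_one] at e1
  simp only [← mul_assoc] at e1
  rw [← Finset.sum_mul] at e1
  have e3 := (mul_eq_zero.1 e1).resolve_right (hank_ne K)
  simp only [mul_assoc] at e3
  have h4 := (minors_le_ker 3 N4 (Ideal.Quotient.mk (minorsIdeal 3 N4))).1
      (by rw [Ideal.mk_ker])
  rw [M4_map] at h4
  have hs := syz_of_V4 _ _ _ _ _ _ _ _ _ _ h4
  simp only [← GG_map] at hs
  have := syz_lemma K _ (Ideal.Quotient.mkₐ K (minorsIdeal 3 N4))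
    (fun i => Ideal.Quotient.mk (minorsIdeal 3 N4) (G i)) (by
      intro i hi j
      have := hs i hi j
      fin_cases j <;> exact this) c e3
  rw [← Ideal.Quotient.eq_zero_iff_mem, map_sum]
  simpa using this
end
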